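/- arXiv:math/0410049 — 14 statements merged into one kernel-verified Lean document; each statement's English description precedes it below -/
import Mathlib

section
/- Every purely infinite simple ring is 1-simple. That is, if R is a (possibly non-unital) ring which is simple and in which every nonzero right ideal contains an infinite idempotent, then for all nonzero x, y ∈ R there exist z, t ∈ R with z*x*t = y. -/
/-- `e` is an idempotent. -/
def IsIdem {A : Type*} [Mul A] (e : A) : Prop := e * e = e

/-- Equivalence of idempotents: `p ~ q` iff `∃ x y, x*y = p ∧ y*x = q`. -/
def IdemEquiv {A : Type*} [Mul A] (p q : A) : Prop := ∃ x y : A, x * y = p ∧ y * x = q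

/-- `e` is an infinite idempotent: `e = f + g` with `f, g` orthogonal idempotents,
`e ~ f` and `g ≠ 0`. -/
def IsInfiniteIdem {A : Type*} [NonUnitalRing A] (e : A) : Prop :=
  ∃ f g : A, IsIdem f ∧ IsIdem g ∧ f * g = 0 ∧ g * f = 0 ∧ e = f + g ∧
    IdemEquiv e f ∧ g ≠ 0

/-- `I` is a right ideal of the (possibly non-unital) ring `A`. -/
def IsRightIdealSet {A : Type*} [NonUnitalRing A] (I : Set A) : Prop :=
  (0 : A) ∈ I ∧ (∀ a ∈ I, ∀ b ∈ I, a + b ∈ I) ∧ (∀ a ∈ I, -a ∈ I) ∧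
    (∀ a ∈ I, ∀ r : A, a * r ∈ I)

/-- `I` is a left ideal of the (possibly non-unital) ring `A`. -/
def IsLeftIdealSet {A : Type*} [NonUnitalRing A] (I : Set A) : Prop :=
  (0 : A) ∈ I ∧ (∀ a ∈ I, ∀ b ∈ I, a + b ∈ I) ∧ (∀ a ∈ I, -a ∈ I) ∧
    (∀ a ∈ I, ∀ r : A, r * a ∈ I)

/-- `I` is a two-sided ideal of the (possibly non-unital) ring `A`. -/
def IsTwoSidedIdealSet {A : Type*} [NonUnitalRing A] (I : Set A) : Prop :=
  (0 : A) ∈ I ∧ (∀ a ∈ I, ∀ b ∈ I, a + b ∈ I) ∧ (∀ a ∈ I, -a ∈ I) ∧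
    (∀ a ∈ I, ∀ r : A, a * r ∈ I ∧ r * a ∈ I)

/-- `A` is a simple ring: nonzero, and its only two-sided ideals are `0` and `A`. -/
def RingIsSimple (A : Type*) [NonUnitalRing A] : Prop :=
  (∃ x : A, x ≠ 0) ∧ ∀ I : Set A, IsTwoSidedIdealSet I → I = {0} ∨ I = Set.univ

/-- `A` is purely infinite simple: simple, and every nonzero right ideal contains
an infinite idempotent. -/
def PurelyInfiniteSimple (A : Type*) [NonUnitalRing A] : Prop :=
  RingIsSimple A ∧ ∀ I : Set A, IsRightIdealSet I → (∃ a ∈ I, a ≠ 0) →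
    ∃ e ∈ I, IsInfiniteIdem e


theorem infinite_spread {R : Type*} [NonUnitalRing R] (e g u v : R)
    (hs : ∀ I : Set R, IsTwoSidedIdealSet I → I = {0} ∨ I = Set.univ)
    (hg : g ≠ 0) (hgg : g * g = g) (hvu : v * u = e) (hvg : v * g = 0) (hgu : g * u = 0)
    (hve : v * e = v) (hge : g * e = g) (hee : e * e = e) (y : R) : ∃ A B : R, y = A * e * B := by
  have step : ∀ Y a b : R, (∃ A B : R, Y = A * e * B) → ∃ A B : R, Y + a * g * b = A * e * B := by
    rintro _ a b ⟨A, B, rfl⟩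
    refine ⟨A * v + a * g, u * B + g * b, ?_⟩
    have h1 : (A * v + a * g) * e = A * v + a * g := by
      rw [add_mul, mul_assoc, hve, mul_assoc, hge]
    have e1 : A * v * (u * B) = A * e * B := by
      rw [← hvu]; simp only [mul_assoc]
    have e2 : A * v * (g * b) = 0 := by
      rw [mul_assoc, ← mul_assoc v, hvg, zero_mul, mul_zero]
    have e3 : a * g * (u * B) = 0 := by
      rw [mul_assoc, ← mul_assoc g, hgu, zero_mul, mul_zero]
    have e4 : a * g * (g * b) = a * g * b := by
      rw [mul_assoc, ← mul_assoc g, hgg, mul_assoc]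
    rw [h1, add_mul, mul_add, mul_add, e1, e2, e3, e4]
    simp
  let G : Set R := {w | ∃ a b : R, w = a * g * b}
  let C := AddSubgroup.closure G
  have hC : IsTwoSidedIdealSet (C : Set R) := by
    refine ⟨C.zero_mem, fun a ha b hb => C.add_mem ha hb, fun a ha => C.neg_mem ha, ?_⟩
    intro w hw r
    induction hw using AddSubgroup.closure_induction with
    | mem w hw =>
      obtain ⟨a, b, rfl⟩ := hw
      exact ⟨AddSubgroup.subset_closure ⟨a, b * r, by simp only [mul_assoc]⟩,
        AddSubgroup.subset_closure ⟨r * a, b, by simp only [mul_assoc]⟩⟩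
    | zero => simp
    | add p q _ _ hp hq =>
      rw [add_mul, mul_add]
      exact ⟨C.add_mem hp.1 hq.1, C.add_mem hp.2 hq.2⟩
    | neg p _ hp =>
      rw [neg_mul, mul_neg]
      exact ⟨C.neg_mem hp.1, C.neg_mem hp.2⟩
  have hgC : g ∈ (C : Set R) := AddSubgroup.subset_closure ⟨g, g, by rw [hgg, hgg]⟩
  have huniv : (C : Set R) = Set.univ := by
    rcases hs _ hC with h | h
    · rw [h] at hgC; exact absurd hgC hg
    · exact h
  have hy : y ∈ C := by
    have : y ∈ (C : Set R) := by rw [huniv]; trivial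
    exact this
  have key : ∀ Y : R, (∃ A B : R, Y = A * e * B) →
      (∃ A B : R, Y + y = A * e * B) ∧ (∃ A B : R, Y + -y = A * e * B) := by
    induction hy using AddSubgroup.closure_induction with
    | mem w hw =>
      obtain ⟨a, b, rfl⟩ := hw
      intro Y hY
      refine ⟨step Y a b hY, ?_⟩
      have := step Y (-a) b hY
      simpa only [neg_mul] using this
    | zero => intro Y hY; simpa using hY
    | add p q _ _ hp hq =>
      intro Y hY
      rw [neg_add, ← add_assoc, ← add_assoc]
      exact ⟨(hq _ (hp _ hY).1).1, (hq _ (hp _ hY).2).2⟩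
    | neg p _ hp =>
      intro Y hY
      rw [neg_neg]
      exact (hp Y hY).symm
  have := (key 0 ⟨0, 0, by simp⟩).1
  simpa using this

/-- Every purely infinite simple ring is 1-simple. -/
theorem purelyInfiniteSimple_oneSimple {R : Type*} [NonUnitalRing R]
    (hR : PurelyInfiniteSimple R) :
    ∀ x y : R, x ≠ 0 → y ≠ 0 → ∃ z t : R, z * x * t = y := by
  intro x y hx _
  obtain ⟨⟨_, hs⟩, hI⟩ := hR
  -- the right ideal `xR` is nonzero
  have hxR : ∃ r, x * r ≠ 0 := by
    by_contra! h
    have hN : IsTwoSidedIdealSet {w : R | ∀ r, w * r = 0} := by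
      refine ⟨fun r => zero_mul r, fun a ha b hb r => ?_, fun a ha r => ?_, fun a ha r =>
        ⟨fun s => ?_, fun s => ?_⟩⟩
      · rw [add_mul, ha r, hb r, add_zero]
      · rw [neg_mul, ha r, neg_zero]
      · rw [mul_assoc]; exact ha _
      · rw [mul_assoc, ha s, mul_zero]
    rcases hs _ hN with h0 | h0
    · have : x ∈ ({0} : Set R) := by rw [← h0]; exact h
      exact hx this
    · obtain ⟨e, _, f, g, _, hg, _, _, _, _, hg0⟩ := hI Set.univ
        ⟨trivial, fun _ _ _ _ => trivial, fun _ _ => trivial, fun _ _ _ => trivial⟩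
        ⟨x, trivial, hx⟩
      have hm : g ∈ {w : R | ∀ r, w * r = 0} := by rw [h0]; trivial
      exact hg0 (hg.symm.trans (hm g))
  obtain ⟨r₀, hr₀⟩ := hxR
  obtain ⟨e, ⟨r, hr⟩, f, g, hf, hg, hfg, hgf, hefg, ⟨p, q, hpq, hqp⟩, hg0⟩ :=
    hI {w | ∃ r, w = x * r}
      ⟨⟨0, by simp⟩, by
        rintro _ ⟨a, rfl⟩ _ ⟨b, rfl⟩
        exact ⟨a + b, by rw [mul_add]⟩, by
        rintro _ ⟨a, rfl⟩
        exact ⟨-a, by rw [mul_neg]⟩, by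
        rintro _ ⟨a, rfl⟩ s
        exact ⟨a * s, by rw [mul_assoc]⟩⟩ ⟨_, ⟨r₀, rfl⟩, hr₀⟩
  unfold IsIdem at hf hg
  have hee : e * e = e := by rw [hefg, add_mul, mul_add, mul_add, hf, hg, hfg, hgf]; simp
  have hfe : f * e = f := by rw [hefg, mul_add, hf, hfg, add_zero]
  have hge : g * e = g := by rw [hefg, mul_add, hg, hgf, zero_add]
  obtain ⟨A, B, hAB⟩ := infinite_spread e g (f * q * e) (e * p * f) hs hg0 hg
    (by
      calc e * p * f * (f * q * e) = e * p * (f * f) * q * e := by simp only [mul_assoc]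
        _ = e * (p * q) * (p * q) * e := by rw [hf, ← hqp]; simp only [mul_assoc]
        _ = e := by rw [hpq, hee, hee, hee])
    (by rw [mul_assoc, hfg, mul_zero])
    (by rw [← mul_assoc, ← mul_assoc, hgf, zero_mul, zero_mul])
    (by rw [mul_assoc, hfe]) hge hee y
  exact ⟨A, r * B, by rw [hAB, hr]; simp only [mul_assoc]⟩
end

section
/- If R is a 1-simple ring containing an infinite idempotent, then R is purely infinite simple; that is, R is simple and every nonzero right ideal of R contains an infinite idempotent. -/
theorem infinite_transport {R : Type*} [NonUnitalRing R] (e z u : R) (he : IsInfiniteIdem e)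
    (hzu : z * u = e) (hez : e * z = z) (hue : u * e = u) : IsInfiniteIdem (u * z) := by
  obtain ⟨f, g, hf, hg, hfg, hgf, hefg, ⟨x0, y0, hxy0, hyx0⟩, hg0⟩ := he
  unfold IsIdem at hf hg
  have hfe : f * e = f := by rw [hefg, mul_add, hf, hfg, add_zero]
  have hef : e * f = f := by rw [hefg, add_mul, hf, hgf, add_zero]
  have hge : g * e = g := by rw [hefg, mul_add, hg, hgf, zero_add]
  have heg : e * g = g := by rw [hefg, add_mul, hg, hfg, zero_add]
  have hee : e * e = e := by
    nth_rewrite 2 [hefg]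
    rw [mul_add, hef, heg, ← hefg]
  have A : ∀ {a b c : R}, a * b = c → ∀ r, a * (b * r) = c * r := by
    intro a b c h r
    rw [← mul_assoc, h]
  obtain ⟨x, y, hxy, hyx, hex, hxf, hfy, hye⟩ : ∃ x y : R, x * y = e ∧ y * x = f ∧ e * x = x ∧
      x * f = x ∧ f * y = y ∧ y * e = y := by
    refine ⟨e * x0 * f, f * y0 * e, ?_, ?_, ?_, ?_, ?_, ?_⟩
    · have : e * x0 * f * (f * y0 * e) = e * ((x0 * y0) * (x0 * y0)) * e := by
        simp only [mul_assoc, A hf]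
        rw [← hyx0]
        simp only [mul_assoc]
      rw [this, hxy0, hee, hee, hee]
    · have : f * y0 * e * (e * x0 * f) = f * ((y0 * x0) * (y0 * x0)) * f := by
        simp only [mul_assoc, A hee]
        rw [← hxy0]
        simp only [mul_assoc]
      rw [this, hyx0, hf, hf, hf]
    all_goals simp only [mul_assoc, A hee, A hf, hee, hf]
  refine ⟨u * f * z, u * g * z, ?_, ?_, ?_, ?_, ?_,
    ⟨u * x * z, u * y * z, ?_, ?_⟩, ?_⟩
  · unfold IsIdem
    simp only [mul_assoc, A hzu, A hfe, A hf]
  · unfold IsIdem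
    simp only [mul_assoc, A hzu, A hge, A hg]
  · simp only [mul_assoc, A hzu, A hfe, A hfg, zero_mul, mul_zero]
  · simp only [mul_assoc, A hzu, A hge, A hgf, zero_mul, mul_zero]
  · rw [← add_mul, ← mul_add, ← hefg, hue]
  · have hey : x * (e * y) = e := by
      rw [← hfy, A hef, A hxf, hxy]
    rw [show u * x * z * (u * y * z) = u * (x * ((z * u) * y)) * z by simp only [mul_assoc],
      hzu, hey, hue]
  · rw [show u * y * z * (u * x * z) = u * (y * ((z * u) * x)) * z by simp only [mul_assoc],
      hzu, hex, hyx]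
  · intro h0
    apply hg0
    have : z * (u * g * z) * u = g := by
      rw [show z * (u * g * z) * u = (z * u) * g * (z * u) by simp only [mul_assoc],
        hzu, heg, hge]
    rw [← this, h0, mul_zero, zero_mul]

theorem infinite_idem_props {R : Type*} [NonUnitalRing R] (e : R) (he : IsInfiniteIdem e) :
    e * e = e ∧ e ≠ 0 := by
  obtain ⟨f, g, hf, hg, hfg, hgf, hefg, -, hg0⟩ := he
  unfold IsIdem at hf hg
  refine ⟨by rw [hefg, add_mul, mul_add, mul_add, hf, hg, hfg, hgf, add_zero, zero_add], ?_⟩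
  intro h
  apply hg0
  have : g * e = g := by rw [hefg, mul_add, hg, hgf, zero_add]
  rw [← this, h, mul_zero]

/-- A 1-simple ring containing an infinite idempotent is purely infinite simple. -/
theorem oneSimple_with_infinite_idem_purelyInfiniteSimple {R : Type*} [NonUnitalRing R]
    (hnz : ∃ x : R, x ≠ 0)
    (h1 : ∀ x y : R, x ≠ 0 → y ≠ 0 → ∃ z t : R, z * x * t = y)
    (he : ∃ e : R, IsInfiniteIdem e) :
    PurelyInfiniteSimple R := by
  refine ⟨⟨hnz, ?_⟩, ?_⟩
  · rintro I ⟨h0, -, -, hm⟩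
    by_cases h : ∃ a ∈ I, a ≠ 0
    · right
      obtain ⟨a, ha, ha0⟩ := h
      ext y
      simp only [Set.mem_univ, iff_true]
      by_cases hy : y = 0
      · rw [hy]; exact h0
      · obtain ⟨z, t, h⟩ := h1 a y ha0 hy
        rw [← h]
        exact (hm _ (hm a ha z).2 t).1
    · left
      push Not at h
      ext y
      simp only [Set.mem_singleton_iff]
      exact ⟨h y, fun hy => hy ▸ h0⟩
  · rintro I ⟨-, -, -, hm⟩ ⟨a, ha, ha0⟩
    obtain ⟨e, he⟩ := he
    obtain ⟨hee, he0⟩ := infinite_idem_props e he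
    obtain ⟨z, t, h⟩ := h1 a e ha0 he0
    refine ⟨a * t * e * (e * z), ?_, infinite_transport e (e * z) (a * t * e) he ?_ ?_ ?_⟩
    · exact hm _ (hm _ (hm _ ha _) _) _
    · rw [show e * z * (a * t * e) = e * (z * a * t) * e by simp only [mul_assoc], h, hee, hee]
    · rw [← mul_assoc, hee]
    · rw [mul_assoc, hee]
end

section
/- The definition of purely infinite simple ring is right-left symmetric: if R is a simple ring in which every nonzero right ideal contains an infinite idempotent, then every nonzero left ideal of R also contains an infinite idempotent (and conversely). -/
/-- If `u * v` is an infinite idempotent, so is `v * (u * v) * u`. -/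
theorem infinite_swap {R : Type*} [NonUnitalRing R] {u v : R} (h : IsInfiniteIdem (u * v)) :
    IsInfiniteIdem (v * (u * v) * u) := by
  obtain ⟨f, g, hf, hg, hfg, hgf, he, ⟨x, y, hxy, hyx⟩, hg0⟩ := h
  unfold IsIdem at hf hg
  generalize hE : u * v = e at *
  have hef : e * f = f := by rw [he, add_mul, hf, hgf, add_zero]
  have hfe : f * e = f := by rw [he, mul_add, hf, hfg, add_zero]
  have heg : e * g = g := by rw [he, add_mul, hg, hfg, zero_add]
  have hge : g * e = g := by rw [he, mul_add, hg, hgf, zero_add]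
  have hee : e * e = e := by
    nth_rewrite 2 [he]
    rw [mul_add, hef, heg, ← he]
  have key : ∀ s t : R, (v * s * u) * (v * t * u) = v * (s * e * t) * u := by
    intro s t
    rw [← hE]; simp only [mul_assoc]
  have h1 : (e * x * f) * e * (f * y * e) = e := by
    calc (e * x * f) * e * (f * y * e) = e * x * ((f * e) * f) * y * e := by
          simp only [mul_assoc]
      _ = e * x * (y * x) * y * e := by rw [hfe, hf, hyx]
      _ = e * ((x * y) * (x * y)) * e := by simp only [mul_assoc]
      _ = e := by rw [hxy, hee, hee, hee]
  have h2 : (f * y * e) * e * (e * x * f) = f := by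
    calc (f * y * e) * e * (e * x * f) = f * y * ((e * e) * e) * x * f := by
          simp only [mul_assoc]
      _ = f * y * (x * y) * x * f := by rw [hee, hee, hxy]
      _ = f * ((y * x) * (y * x)) * f := by simp only [mul_assoc]
      _ = f := by rw [hyx, hf, hf, hf]
  refine ⟨v * f * u, v * g * u, ?_, ?_, ?_, ?_, ?_,
    ⟨v * (e * x * f) * u, v * (f * y * e) * u, ?_, ?_⟩, ?_⟩
  · unfold IsIdem
    rw [key, hfe, hf]
  · unfold IsIdem
    rw [key, hge, hg]
  · rw [key, hfe, hfg, mul_zero, zero_mul]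
  · rw [key, hge, hgf, mul_zero, zero_mul]
  · rw [← add_mul, ← mul_add, ← he]
  · rw [key, h1]
  · rw [key, h2]
  · intro h0
    apply hg0
    calc g = e * g * e := by rw [heg, hge]
      _ = u * (v * g * u) * v := by rw [← hE]; simp only [mul_assoc]
      _ = 0 := by rw [h0, mul_zero, zero_mul]

theorem not_all_zero {R : Type*} [NonUnitalRing R] {e : R} (h : IsInfiniteIdem e)
    (hz : ∀ a b : R, a * b = 0) : False := by
  obtain ⟨f, g, hf, hg, hfg, hgf, he, _, hg0⟩ := h
  exact hg0 (by rw [← hg, hz])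

/-- The definition of purely infinite simple ring is right-left symmetric. -/
theorem purelyInfiniteSimple_left_right_symmetric {R : Type*} [NonUnitalRing R]
    (hs : RingIsSimple R) :
    (∀ I : Set R, IsRightIdealSet I → (∃ a ∈ I, a ≠ 0) → ∃ e ∈ I, IsInfiniteIdem e) ↔
      (∀ I : Set R, IsLeftIdealSet I → (∃ a ∈ I, a ≠ 0) → ∃ e ∈ I, IsInfiniteIdem e) := by
  constructor
  · intro H I hI ⟨a, ha, ha0⟩
    have hnz : ∃ r, a * r ≠ 0 := by
      by_contra! hc
      have hT : IsTwoSidedIdealSet {b : R | ∀ r, b * r = 0} := by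
        refine ⟨fun r => zero_mul r, fun a ha b hb r => ?_, fun a ha r => ?_,
          fun a ha s => ⟨fun r => ?_, fun r => ?_⟩⟩
        · rw [add_mul, ha, hb, add_zero]
        · rw [neg_mul, ha, neg_zero]
        · rw [mul_assoc, ha]
        · rw [mul_assoc, ha, mul_zero]
      rcases hs.2 _ hT with h | h
      · have : a ∈ ({0} : Set R) := h ▸ hc
        exact ha0 this
      · obtain ⟨e, -, he⟩ := H Set.univ
          ⟨trivial, fun _ _ _ _ => trivial, fun _ _ => trivial, fun _ _ _ => trivial⟩
          ⟨a, trivial, ha0⟩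
        refine not_all_zero he fun b c => ?_
        have : b ∈ {b : R | ∀ r, b * r = 0} := h ▸ Set.mem_univ b
        exact this c
    obtain ⟨r, hr⟩ := hnz
    obtain ⟨e, ⟨v, rfl⟩, he⟩ := H {z | ∃ s, z = a * s}
      ⟨⟨0, by simp⟩, by rintro _ ⟨s, rfl⟩ _ ⟨t, rfl⟩; exact ⟨s + t, by rw [mul_add]⟩,
        by rintro _ ⟨s, rfl⟩; exact ⟨-s, by rw [mul_neg]⟩,
        by rintro _ ⟨s, rfl⟩ t; exact ⟨s * t, by rw [mul_assoc]⟩⟩ ⟨a * r, ⟨r, rfl⟩, hr⟩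
    exact ⟨_, hI.2.2.2 a ha _, infinite_swap he⟩
  · intro H I hI ⟨a, ha, ha0⟩
    have hnz : ∃ r, r * a ≠ 0 := by
      by_contra! hc
      have hT : IsTwoSidedIdealSet {b : R | ∀ r, r * b = 0} := by
        refine ⟨fun r => mul_zero r, fun a ha b hb r => ?_, fun a ha r => ?_,
          fun a ha s => ⟨fun r => ?_, fun r => ?_⟩⟩
        · rw [mul_add, ha, hb, add_zero]
        · rw [mul_neg, ha, neg_zero]
        · rw [← mul_assoc, ha, zero_mul]
        · rw [← mul_assoc, ha]
      rcases hs.2 _ hT with h | h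
      · have : a ∈ ({0} : Set R) := h ▸ hc
        exact ha0 this
      · obtain ⟨e, -, he⟩ := H Set.univ
          ⟨trivial, fun _ _ _ _ => trivial, fun _ _ => trivial, fun _ _ _ => trivial⟩
          ⟨a, trivial, ha0⟩
        refine not_all_zero he fun b c => ?_
        have : c ∈ {b : R | ∀ r, r * b = 0} := h ▸ Set.mem_univ c
        exact this b
    obtain ⟨r, hr⟩ := hnz
    obtain ⟨e, ⟨v, rfl⟩, he⟩ := H {z | ∃ s, z = s * a}
      ⟨⟨0, by simp⟩, by rintro _ ⟨s, rfl⟩ _ ⟨t, rfl⟩; exact ⟨s + t, by rw [add_mul]⟩,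
        by rintro _ ⟨s, rfl⟩; exact ⟨-s, by rw [neg_mul]⟩,
        by rintro _ ⟨s, rfl⟩ t; exact ⟨t * s, by rw [mul_assoc]⟩⟩ ⟨r * a, ⟨r, rfl⟩, hr⟩
    refine ⟨_, ?_, infinite_swap he⟩
    rw [mul_assoc]
    exact hI.2.2.2 a ha _
end

section
/- If R is a unital 1-simple ring, then R is either a division ring or a purely infinite simple ring. That is, if R is a nonzero unital ring such that for all nonzero x, y ∈ R there exist z, t ∈ R with z*x*t = y, then either every nonzero element of R is invertible, or R is simple and every nonzero right ideal of R contains an infinite idempotent. -/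
/-- A unital 1-simple ring is either a division ring or purely infinite simple. -/
theorem unital_oneSimple_dichotomy {R : Type*} [Ring R] [Nontrivial R]
    (h1 : ∀ x y : R, x ≠ 0 → y ≠ 0 → ∃ z t : R, z * x * t = y) :
    (∀ x : R, x ≠ 0 → IsUnit x) ∨ PurelyInfiniteSimple R := by
  by_cases hdf : ∀ u v : R, u * v = 1 → v * u = 1
  · left
    intro x hx
    obtain ⟨z, t, h⟩ := h1 x 1 hx one_ne_zero
    have e1 : x * (t * z) = 1 := by
      have := hdf z (x * t) (by rw [← mul_assoc]; exact h)
      rwa [mul_assoc] at this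
    have e2 : (t * z) * x = 1 := by
      have := hdf (z * x) t h
      rwa [← mul_assoc] at this
    exact ⟨⟨x, t * z, e1, e2⟩, rfl⟩
  · right
    push Not at hdf
    obtain ⟨u, v, huv, hvu⟩ := hdf
    refine ⟨⟨⟨1, one_ne_zero⟩, ?_⟩, ?_⟩
    · rintro I ⟨h0, -, -, hm⟩
      by_cases hI : ∃ a ∈ I, a ≠ 0
      · right
        obtain ⟨a, ha, hne⟩ := hI
        obtain ⟨z, t, h⟩ := h1 a 1 hne one_ne_zero
        have h1I : (1 : R) ∈ I := h ▸ (hm _ (hm a ha z).2 t).1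
        ext r
        simpa using (hm 1 h1I r).1
      · left
        push Not at hI
        ext r
        exact ⟨fun hr => hI r hr, fun hr => by rw [Set.mem_singleton_iff.1 hr]; exact h0⟩
    · rintro I ⟨-, -, -, hm⟩ ⟨a, ha, hne⟩
      obtain ⟨z, t, h⟩ := h1 a 1 hne one_ne_zero
      have hwI : a * t * z ∈ I := hm _ (hm a ha t) z
      generalize hw : a * t = w at hwI
      have hzw : z * w = 1 := by rw [← hw, ← mul_assoc]; exact h
      have hzw' : ∀ r, z * (w * r) = r := fun r => by rw [← mul_assoc, hzw, one_mul]
      have huv' : ∀ r, u * (v * r) = r := fun r => by rw [← mul_assoc, huv, one_mul]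
      refine ⟨w * z, hwI, w * (v * u) * z, w * (1 - v * u) * z, ?_, ?_, ?_, ?_, ?_,
        ⟨w * u * z, w * v * z, ?_, ?_⟩, ?_⟩
      · simp [IsIdem, mul_assoc, hzw', huv']
      · simp [IsIdem, mul_assoc, hzw', huv', mul_sub, sub_mul]
      · simp [mul_assoc, hzw', huv', mul_sub, sub_mul]
      · simp [mul_assoc, hzw', huv', mul_sub, sub_mul]
      · simp [mul_assoc, mul_sub, sub_mul]
      · simp [mul_assoc, hzw', huv']
      · simp [mul_assoc, hzw', huv']
      · intro hg
        apply hvu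
        have : z * (w * (1 - v * u) * z) * w = 1 - v * u := by
          simp only [mul_assoc, hzw', hzw, mul_one]
        rw [hg, mul_zero, zero_mul] at this
        exact (sub_eq_zero.1 this.symm).symm
end

section
/- Every purely infinite simple ring is an exchange ring: if R is a (possibly non-unital) simple ring in which every nonzero right ideal contains an infinite idempotent, then for every a ∈ R there exist an idempotent e ∈ R and elements r, s ∈ R such that e = r*a and e = a + s - s*a. -/
/-- In a simple ring, every element factors through a given infinite idempotent. -/
lemma factor_through {R : Type*} [NonUnitalRing R] (hs : RingIsSimple R) (e : R)
    (he : IsInfiniteIdem e) : e * e = e ∧ ∀ z : R, ∃ x y : R, z = x * (e * y) := by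
  obtain ⟨f, g, hf, hg, hfg, hgf, rfl, ⟨X, Y, hXY, hYX⟩, hg0⟩ := he
  unfold IsIdem at hf hg
  set e := f + g with he
  have hee : e * e = e := by rw [he]; simp only [mul_add, add_mul, hf, hg, hfg, hgf]; abel
  have hef : e * f = f := by rw [he]; simp only [add_mul, hf, hgf]; abel
  have hfe : f * e = f := by rw [he]; simp only [mul_add, hf, hfg]; abel
  have heg : e * g = g := by rw [he]; simp only [add_mul, hg, hfg]; abel
  have hge : g * e = g := by rw [he]; simp only [mul_add, hg, hgf]; abel
  refine ⟨hee, ?_⟩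
  let T : Set R := {z | ∃ x y σ τ : R, z = x * y ∧ x * e = x ∧ e * y = y ∧ τ * σ = e ∧
    x * σ = 0 ∧ τ * y = 0 ∧ e * σ = σ ∧ τ * e = τ}
  have hT : IsTwoSidedIdealSet T := by
    refine ⟨⟨0, 0, e, e, by simp [hee]⟩, ?_, ?_, ?_⟩
    · rintro _ ⟨x, y, σ, τ, rfl, h1, h2, h3, h4, h5, h6, h7⟩ _
        ⟨x', y', σ', τ', rfl, k1, k2, k3, k4, k5, k6, k7⟩
      refine ⟨x + x' * τ, y + σ * y', σ * σ', τ' * τ, ?_, ?_, ?_, ?_, ?_, ?_, ?_, ?_⟩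
      · have a1 : x * (σ * y') = 0 := by rw [← mul_assoc, h4, zero_mul]
        have a2 : x' * τ * y = 0 := by rw [mul_assoc, h5, mul_zero]
        have a3 : x' * τ * (σ * y') = x' * y' := by
          rw [mul_assoc, ← mul_assoc τ, h3, k2]
        rw [mul_add, add_mul, add_mul, a1, a2, a3]; abel
      · rw [add_mul, mul_assoc, h7, h1]
      · rw [mul_add, ← mul_assoc, h6, h2]
      · rw [mul_assoc, ← mul_assoc τ, h3, k6, k3]
      · rw [add_mul, ← mul_assoc, h4, zero_mul, mul_assoc, ← mul_assoc τ, h3, k6, k4, zero_add]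
      · rw [mul_add, mul_assoc, h5, mul_zero, mul_assoc, ← mul_assoc τ, h3, k2, k5, zero_add]
      · rw [← mul_assoc, h6]
      · rw [mul_assoc, h7]
    · rintro _ ⟨x, y, σ, τ, rfl, h1, h2, h3, h4, h5, h6, h7⟩
      exact ⟨-x, y, σ, τ, by rw [neg_mul], by rw [neg_mul, h1], h2, h3,
        by rw [neg_mul, h4, neg_zero], h5, h6, h7⟩
    · rintro _ ⟨x, y, σ, τ, rfl, h1, h2, h3, h4, h5, h6, h7⟩ r
      exact ⟨⟨x, y * r, σ, τ, by rw [mul_assoc], h1, by rw [← mul_assoc, h2], h3, h4,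
          by rw [← mul_assoc, h5, zero_mul], h6, h7⟩,
        ⟨r * x, y, σ, τ, by rw [mul_assoc], by rw [mul_assoc, h1], h2, h3,
          by rw [mul_assoc, h4, mul_zero], h5, h6, h7⟩⟩
  have hgT : g ∈ T := by
    refine ⟨g, g, f * (Y * e), e * (X * f), hg.symm, hge, heg, ?_, ?_, ?_, ?_, ?_⟩
    · calc e * (X * f) * (f * (Y * e)) = e * (X * (f * f) * Y) * e := by noncomm_ring
        _ = e * ((X * Y) * (X * Y)) * e := by rw [hf, ← hYX]; noncomm_ring
        _ = e := by rw [hXY, hee, hee, hee]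
    · rw [← mul_assoc, hgf, zero_mul]
    · rw [mul_assoc, mul_assoc, hfg, mul_zero, mul_zero]
    · rw [← mul_assoc, hef]
    · rw [mul_assoc, mul_assoc, hfe]
  rcases hs.2 T hT with h | h
  · rw [h] at hgT; exact absurd hgT hg0
  · intro z
    have hz : z ∈ T := by rw [h]; trivial
    obtain ⟨x, y, σ, τ, h0, h1, h2, -⟩ := hz
    exact ⟨x, y, by rw [h2, h0]⟩

/-- The explicit exchange construction. -/
lemma exchange_aux {R : Type*} [NonUnitalRing R] (a p r x y m n : R) (hp : p * p = p)
    (hr : p = r * a - r * a * a) (hxy : x * p * y = a)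
    (hm : m = x * p - p * x * p) (hn : n = p * y * a - p * y * a * p) :
    ∃ e r s : R, IsIdem e ∧ e = r * a ∧ e = a + s - s * a := by
  have hpm : p * m = 0 := by
    rw [hm, mul_sub, ← mul_assoc, ← mul_assoc, ← mul_assoc, hp, sub_self]
  have hmp : m * p = m := by rw [hm, sub_mul, mul_assoc, mul_assoc (p * x), hp]
  have hpn : p * n = n := by
    rw [hn, mul_sub]; simp only [← mul_assoc]; rw [hp]
  have hnp : n * p = 0 := by rw [hn, sub_mul, mul_assoc (p * y * a), hp, sub_self]
  have hmm : m * m = 0 := by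
    nth_rewrite 1 [← hmp]
    rw [mul_assoc, hpm, mul_zero]
  have hnn : n * n = 0 := by
    nth_rewrite 2 [← hpn]
    rw [← mul_assoc, hnp, zero_mul]
  obtain ⟨c, hc⟩ : ∃ c, c = a * a - a * a * p := ⟨_, rfl⟩
  have hmn : m * n = c - p * c := by
    have h1 : x * n = c := by
      rw [hn, hc, mul_sub]; simp only [← mul_assoc]; rw [hxy]
    have h2 : m = x * p - p * (x * p) := by rw [hm, mul_assoc]
    rw [h2, sub_mul, mul_assoc, hpn, h1, mul_assoc, mul_assoc x, hpn, h1]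
  have hnmn : n * (m * n) = n * c := by
    rw [hmn, mul_sub, ← mul_assoc, hnp, zero_mul, sub_zero]
  obtain ⟨w, hw⟩ : ∃ w, w = a - r * a + a * a * r * a - m * r * a := ⟨_, rfl⟩
  have hwa : w - w * a = a - c - p - m := by
    have : w - w * a = a - a * a - (r * a - r * a * a) + a * a * (r * a - r * a * a)
        - m * (r * a - r * a * a) := by rw [hw]; noncomm_ring
    rw [this, ← hr, hmp, hc]; abel
  obtain ⟨v, hv⟩ : ∃ v, v = p + m - n * m := ⟨_, rfl⟩
  have hvp : v * p = v := by rw [hv, sub_mul, add_mul, mul_assoc, hp, hmp]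
  have hvm : v * m = 0 := by
    rw [hv, sub_mul, add_mul, mul_assoc, hpm, hmm, mul_zero]; abel
  have hv2 : v + n * v = p + m := by
    rw [hv, mul_sub, mul_add, hnp, ← mul_assoc, hnn, zero_mul]; abel
  refine ⟨v + v * n, v * (r - r * a) + v * (p * y - p * y * a * (r - r * a)),
    p + n - w + p * w + n * w, ?_, ?_, ?_⟩
  · show (v + v * n) * (v + v * n) = v + v * n
    calc (v + v * n) * (v + v * n) = v * (v + n * v) + v * (v + n * v) * n := by noncomm_ring
      _ = _ := by rw [hv2, mul_add, hvp, hvm, add_zero]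
  · have h1 : (r - r * a) * a = p := by rw [sub_mul, ← hr]
    rw [add_mul, mul_assoc, h1, hvp, mul_assoc, sub_mul, mul_assoc (p * y * a), h1, ← hn]
  · have h1 : a + (p + n - w + p * w + n * w) - (p + n - w + p * w + n * w) * a
        = a + (p + n) - (p + n) * a - (w - w * a) + (p + n) * (w - w * a) := by noncomm_ring
    have h2 : v * n = n + m * n - n * (m * n) := by
      rw [hv, sub_mul, add_mul, hpn, mul_assoc]
    rw [h1, hwa, h2, hnmn, hmn, hv]
    simp only [add_mul, mul_sub, hp, hnp, hpm]
    abel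

/-- Every purely infinite simple ring is an exchange ring. -/
theorem purelyInfiniteSimple_exchange {R : Type*} [NonUnitalRing R]
    (hR : PurelyInfiniteSimple R) :
    ∀ a : R, ∃ e r s : R, IsIdem e ∧ e = r * a ∧ e = a + s - s * a := by
  intro a
  by_cases h : a - a * a = 0
  · have ha : a * a = a := (sub_eq_zero.1 h).symm
    exact ⟨a, a, a, ha, ha.symm, by rw [ha]; abel⟩
  obtain ⟨c, hc⟩ : ∃ c, c = a - a * a := ⟨_, rfl⟩
  rw [← hc] at h
  obtain ⟨e, ⟨r, k, hrk⟩, hinf⟩ := hR.2 {z | ∃ (r : R) (k : ℤ), z = c * r + k • c} (by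
    refine ⟨⟨0, 0, by simp⟩, ?_, ?_, ?_⟩
    · rintro _ ⟨r, k, rfl⟩ _ ⟨r', k', rfl⟩
      exact ⟨r + r', k + k', by rw [mul_add, add_smul]; abel⟩
    · rintro _ ⟨r, k, rfl⟩
      exact ⟨-r, -k, by rw [mul_neg, neg_smul]; abel⟩
    · rintro _ ⟨r, k, rfl⟩ t
      exact ⟨r * t + k • t, 0, by
        rw [mul_add, add_mul, mul_smul_comm, smul_mul_assoc, zero_smul, mul_assoc, add_zero]⟩)
    ⟨c, ⟨0, 1, by simp⟩, h⟩
  obtain ⟨hee, hfac⟩ := factor_through hR.1 e hinf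
  obtain ⟨x, y, hxy⟩ := hfac a
  obtain ⟨q, hq⟩ : ∃ q, q = (r * e + k • e) * e := ⟨_, rfl⟩
  have hqe : q * e = q := by rw [hq, mul_assoc, hee]
  have hcq : c * q = e := by
    have : c * q = (c * r + k • c) * e * e := by
      rw [hq, ← mul_assoc, mul_add, mul_smul_comm, ← smul_mul_assoc, ← mul_assoc, ← add_mul]
    rw [this, ← hrk, hee, hee]
  refine exchange_aux a (q * c) q (x * c) (q * y) _ _ ?_ ?_ ?_ rfl rfl
  · rw [mul_assoc, ← mul_assoc c, hcq, ← mul_assoc, hqe]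
  · rw [hc, mul_sub, mul_assoc]
  · calc x * c * (q * c) * (q * y) = x * ((c * q) * (c * q) * y) := by noncomm_ring
      _ = a := by rw [hcq, hee, hxy]
end

section
/- Every s-unital exchange ring is a ring with local units: if R is an exchange ring such that for every a ∈ R there exists u ∈ R with u*a = a and a*u = a, then for every finite family x_1, ..., x_m ∈ R there exists an idempotent h ∈ R with h*x_i = x_i and x_i*h = x_i for all i (equivalently, x_i ∈ hRh for all i). -/
/-- `A` is an exchange ring (Ara's definition for possibly non-unital rings). -/
def IsExchangeRing (A : Type*) [NonUnitalRing A] : Prop :=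
  ∀ a : A, ∃ e r s : A, IsIdem e ∧ e = r * a ∧ e = a + s - s * a

/-- Right-handed version of the exchange condition. -/
theorem exchange_right {R : Type*} [NonUnitalRing R] (hex : IsExchangeRing R) (a : R) :
    ∃ f c : R, f * f = f ∧ f = a + c - a * c := by
  obtain ⟨e, r, s, he, h1, h2⟩ := hex a
  unfold IsIdem at he
  obtain ⟨X, hX⟩ : ∃ X, X = e * r + e + s - e * s := ⟨_, rfl⟩
  have hsa : s * a = a + s - e := by rw [h2]; abel
  have hera : e * r * a = e := by rw [mul_assoc, ← h1, he]
  have hXa : X * a = a + s + e - e * s := by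
    rw [hX]
    simp only [add_mul, sub_mul, mul_assoc e s a, hsa, hera, mul_add, mul_sub, he]
    abel
  have heX : e * X = X - X * a + a + e := by
    rw [hXa, hX]
    simp only [mul_add, mul_sub, ← mul_assoc, he]
    abel
  have heq : e = a * a + X * (a - a * a) := by
    rw [mul_sub, ← mul_assoc, hXa]
    simp only [mul_add, mul_sub, add_mul, sub_mul, mul_assoc e s a, hsa, he]
    abel
  have hXf : X * (a * a + (a - a * a) * X) = X + a + a * a - a * a * X := by
    have h3 : X * (a - a * a) = e - a * a := by
      rw [eq_sub_iff_add_eq, add_comm]; exact heq.symm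
    have h4 : X * (a * a) = X * a - e + a * a := by
      rw [mul_sub] at h3
      rw [sub_eq_iff_eq_add] at h3
      rw [h3]; abel
    rw [mul_add, ← mul_assoc X (a - a * a) X, h3, sub_mul, heX, h4]
    abel
  refine ⟨a * a + (a - a * a) * X, a * X - a, ?_, ?_⟩
  · rw [add_mul, mul_assoc (a - a * a) X, hXf]
    simp only [mul_add, mul_sub, add_mul, sub_mul, mul_assoc]
    abel
  · simp only [mul_add, mul_sub, add_mul, sub_mul, mul_assoc]
    abel

theorem sUnital_pair {R : Type*} [NonUnitalRing R]
    (hsu : ∀ a : R, ∃ u : R, u * a = a ∧ a * u = a) (x y : R) :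
    ∃ u : R, u * x = x ∧ u * y = y ∧ x * u = x ∧ y * u = y := by
  obtain ⟨u, hu, hu'⟩ := hsu x
  obtain ⟨v, hv, -⟩ := hsu (y - u * y)
  obtain ⟨w, -, hw⟩ := hsu (y - y * u)
  have hv1 : v * y - v * (u * y) = y - u * y := by rw [← mul_sub, hv]
  have hw1 : y * w - y * (u * w) = y - y * u := by
    rw [← mul_assoc, ← sub_mul, hw]
  obtain ⟨p, hp⟩ : ∃ p, p = u + v - v * u := ⟨_, rfl⟩
  obtain ⟨q, hq⟩ : ∃ q, q = u + w - u * w := ⟨_, rfl⟩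
  have px : p * x = x := by
    rw [hp, sub_mul, add_mul, mul_assoc, hu]; abel
  have py : p * y = y := by
    rw [hp, sub_mul, add_mul, mul_assoc, add_sub_assoc, hv1]; abel
  have qx : x * q = x := by
    rw [hq, mul_sub, mul_add, ← mul_assoc, hu']; abel
  have qy : y * q = y := by
    rw [hq, mul_sub, mul_add, add_sub_assoc, hw1]; abel
  refine ⟨p + q - q * p, ?_, ?_, ?_, ?_⟩
  · rw [sub_mul, add_mul, mul_assoc, px]; abel
  · rw [sub_mul, add_mul, mul_assoc, py]; abel
  · rw [mul_sub, mul_add, ← mul_assoc, qx]; abel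
  · rw [mul_sub, mul_add, ← mul_assoc, qy]; abel

theorem idem_pair {R : Type*} [NonUnitalRing R] (hex : IsExchangeRing R)
    (hsu : ∀ a : R, ∃ u : R, u * a = a ∧ a * u = a) (x y : R) :
    ∃ h : R, IsIdem h ∧ h * x = x ∧ h * y = y ∧ x * h = x ∧ y * h = y := by
  obtain ⟨u, ux, uy, xu, yu⟩ := sUnital_pair hsu x y
  obtain ⟨e, r, s, he, h1, h2⟩ := hex u
  obtain ⟨v, -, uv⟩ := hsu u
  obtain ⟨f, c, hf, hc⟩ := exchange_right hex v
  have uf : u * f = u := by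
    rw [hc, mul_sub, mul_add, ← mul_assoc, uv]; abel
  have ef : e * f = e := by rw [h1, mul_assoc, uf]
  have key : ∀ z, u * z = z → e * z = z := by
    intro z hz
    rw [h2, sub_mul, add_mul, mul_assoc, hz]; abel
  have key2 : ∀ z, z * u = z → z * f = z := by
    intro z hz
    rw [← hz, mul_assoc, uf]
  have ex := key x ux
  have ey := key y uy
  have xf := key2 x xu
  have yf := key2 y yu
  unfold IsIdem at he
  refine ⟨f + e - f * e, ?_, ?_, ?_, ?_, ?_⟩
  · unfold IsIdem
    have h3 : e * (f + e - f * e) = e := by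
      rw [mul_sub, mul_add, ← mul_assoc, ef, he]; abel
    have h4 : f * (f + e - f * e) = f := by
      rw [mul_sub, mul_add, ← mul_assoc, hf]; abel
    rw [sub_mul, add_mul, mul_assoc f e, h3, h4]
  · rw [sub_mul, add_mul, mul_assoc, ex]; abel
  · rw [sub_mul, add_mul, mul_assoc, ey]; abel
  · rw [mul_sub, mul_add, ← mul_assoc, xf]; abel
  · rw [mul_sub, mul_add, ← mul_assoc, yf]; abel

/-- Every s-unital exchange ring is a ring with local units. -/
theorem sUnital_exchange_localUnits {R : Type*} [NonUnitalRing R]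
    (hex : IsExchangeRing R)
    (hsu : ∀ a : R, ∃ u : R, u * a = a ∧ a * u = a) :
    ∀ (m : ℕ) (x : Fin m → R), ∃ h : R, IsIdem h ∧
      ∀ i, h * x i = x i ∧ x i * h = x i := by
  intro m
  induction m with
  | zero => exact fun x => ⟨0, by simp [IsIdem], fun i => i.elim0⟩
  | succ m ih =>
    intro x
    obtain ⟨k, -, hk⟩ := ih (fun i => x i.castSucc)
    obtain ⟨h, hh, h1, h2, h3, h4⟩ := idem_pair hex hsu k (x (Fin.last m))
    refine ⟨h, hh, fun i => ?_⟩
    refine Fin.lastCases ⟨h2, h4⟩ (fun j => ?_) i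
    obtain ⟨a, b⟩ := hk j
    constructor
    · rw [← a, ← mul_assoc, h1]
    · rw [← b, mul_assoc, h3]
end

section
/- Every σ-unital exchange ring is a ring with countable unit: if R is an exchange ring admitting a sequence (u_n) in R such that for every a ∈ R there is N with u_n*a = a and a*u_n = a for all n ≥ N, then there exists a sequence of idempotents (e_n) in R with e_n*e_{n+1} = e_{n+1}*e_n = e_n for all n, such that for every a ∈ R there is n with e_n*a*e_n = a. -/
/-- Right-handed version of the exchange property (Nicholson symmetry, elementwise). -/
theorem right_exchange {R : Type*} [NonUnitalRing R] (hex : IsExchangeRing R) (a : R) :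
    ∃ f c : R, f * f = f ∧ f = a * a + (a - a * a) * c := by
  obtain ⟨e, r, s, he, h1, h2⟩ := hex a
  unfold IsIdem at he
  have hsa : s * a = a + s - e := by rw [h2]; abel
  have hra : r * a = e := h1.symm
  obtain ⟨c, hc⟩ : ∃ c, c = e * r + s + e - e * s := ⟨_, rfl⟩
  have hec : e * c = e * r + e := by
    rw [hc]
    simp only [mul_add, mul_sub, ← mul_assoc, he]
    abel
  have hca : c * a = a + c + e - e * c := by
    rw [hec, hc]
    simp only [add_mul, sub_mul, mul_assoc, hra, hsa, mul_add, mul_sub, he]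
    abel
  have hcd : c * (a - a * a) = e - a * a := by
    have h3 : e * (c * a) = e * a + e := by
      rw [hca]
      simp only [mul_add, mul_sub, ← mul_assoc, he]
      abel
    have h4 : c * (a * a) = a * a + c * a + e * a - (e * a + e) := by
      rw [← h3, ← mul_assoc, hca]
      simp only [add_mul, sub_mul, mul_assoc]
      rw [hca]
    rw [mul_sub, h4]
    abel
  have hcaa : c * (a * a) = c + a + a * a - e * c := by
    have : c * (a * a) = c * a - c * (a - a * a) := by rw [mul_sub]; abel
    rw [this, hcd, hca]; abel
  refine ⟨_, c, ?_, rfl⟩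
  have h5 : (a * a + (a - a * a) * c) * (a * a + (a - a * a) * c)
      = a * a * (a * a) + a * a * (a - a * a) * c + (a - a * a) * (c * (a * a))
        + (a - a * a) * (c * (a - a * a)) * c := by
    simp only [mul_add, add_mul, mul_assoc]
    abel
  rw [h5, hcaa, hcd]
  simp only [mul_add, add_mul, mul_sub, sub_mul, mul_assoc]
  abel

theorem exists_local_unit {R : Type*} [NonUnitalRing R] (hex : IsExchangeRing R)
    (hu : ∀ a b : R, ∃ v : R, (v * a = a ∧ a * v = a) ∧ (v * b = b ∧ b * v = b)) (a b : R) :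
    ∃ g : R, g * g = g ∧ (g * a = a ∧ a * g = a) ∧ (g * b = b ∧ b * g = b) := by
  obtain ⟨v, ⟨va, av⟩, vb, bv⟩ := hu a b
  obtain ⟨w, ⟨wv, -⟩, -⟩ := hu v v
  obtain ⟨e, r, s, he, -, h2⟩ := hex w
  unfold IsIdem at he
  have ev : e * v = v := by
    rw [h2]
    simp only [add_mul, sub_mul, mul_assoc, wv]
    abel
  obtain ⟨y, ⟨ye, ey⟩, yv, vy⟩ := hu e v
  obtain ⟨f, c, hf, hfc⟩ := right_exchange hex (y - e)
  have hew : e * (y - e) = 0 := by rw [mul_sub, ey, he, sub_self]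
  have hef : e * f = 0 := by
    rw [hfc]
    simp only [mul_add, mul_sub (e), ← mul_assoc, ey, he, zero_mul, sub_self, add_zero]
  have hxw : (v - v * e) * (y - e) = v - v * e := by
    simp only [sub_mul, mul_sub, mul_assoc, ey, he, vy]
    abel
  have hxf : (v - v * e) * f = v - v * e := by
    have hxww : (v - v * e) * ((y - e) * (y - e)) = v - v * e := by
      rw [← mul_assoc, hxw, hxw]
    rw [hfc, mul_add, ← mul_assoc _ _ c, mul_sub (v - v * e) (y - e), hxww, hxw,
      sub_self, zero_mul, add_zero]
  have hvf : v * f = v - v * e := by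
    rw [← hxf, sub_mul, mul_assoc v e f, hef, mul_zero, sub_zero]
  have hfev : f * (e * v) = f * v := by rw [ev]
  have hg : (e + (f - f * e)) * v = v := by
    simp only [add_mul, sub_mul, mul_assoc, ev]
    abel
  have hg' : v * (e + (f - f * e)) = v := by
    simp only [mul_add, mul_sub, ← mul_assoc, hvf]
    simp only [sub_mul, mul_assoc, he]
    abel
  refine ⟨e + (f - f * e), ?_, ⟨?_, ?_⟩, ?_, ?_⟩
  · have hef' : ∀ x, e * (f * x) = 0 := fun x => by rw [← mul_assoc, hef, zero_mul]
    have hff' : ∀ x, f * (f * x) = f * x := fun x => by rw [← mul_assoc, hf]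
    simp only [add_mul, mul_add, sub_mul, mul_sub, mul_assoc, he, hef, hef', hf, hff', mul_zero]
    abel
  · rw [← va, ← mul_assoc, hg]
  · rw [← av, mul_assoc, hg']
  · rw [← vb, ← mul_assoc, hg]
  · rw [← bv, mul_assoc, hg']

/-- Every σ-unital exchange ring is a ring with countable unit. -/
theorem sigmaUnital_exchange_countableUnit {R : Type*} [NonUnitalRing R]
    (hex : IsExchangeRing R)
    (hsigma : ∃ u : ℕ → R, ∀ a : R, ∃ N : ℕ, ∀ n ≥ N, u n * a = a ∧ a * u n = a) :
    ∃ e : ℕ → R, (∀ n, IsIdem (e n)) ∧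
      (∀ n, e n * e (n + 1) = e n ∧ e (n + 1) * e n = e n) ∧
      ∀ a : R, ∃ n, e n * a * e n = a := by
  obtain ⟨u, hu⟩ := hsigma
  have h2 : ∀ a b : R, ∃ v : R, (v * a = a ∧ a * v = a) ∧ (v * b = b ∧ b * v = b) := by
    intro a b
    obtain ⟨N, hN⟩ := hu a
    obtain ⟨M, hM⟩ := hu b
    exact ⟨u (max N M), hN _ (le_max_left _ _), hM _ (le_max_right _ _)⟩
  choose g hg hga hgb using exists_local_unit hex h2
  let e : ℕ → R := fun n => Nat.rec (g 0 0) (fun n x => g x (u n)) n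
  have hs : ∀ n, e (n + 1) = g (e n) (u n) := fun n => rfl
  refine ⟨e, ?_, ?_, ?_⟩
  · intro n
    cases n with
    | zero => exact hg 0 0
    | succ n => exact hg _ _
  · intro n
    rw [hs]
    exact ⟨(hga _ _).2, (hga _ _).1⟩
  · intro a
    obtain ⟨N, hN⟩ := hu a
    obtain ⟨h3, h4⟩ := hN N le_rfl
    refine ⟨N + 1, ?_⟩
    have h5 : e (N + 1) * a = a := by
      rw [← h3, ← mul_assoc, hs, (hgb _ _).1]
    have h6 : a * e (N + 1) = a := by
      rw [← h4, mul_assoc, hs, (hgb _ _).2]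
    rw [h5, h6]
end

section
/- Every σ-unital purely infinite simple ring has a countable unit: if R is a simple ring in which every nonzero right ideal contains an infinite idempotent, and R admits a sequence (u_n) such that for every a ∈ R there is N with u_n*a = a and a*u_n = a for all n ≥ N, then there exists a sequence of idempotents (e_n) in R with e_n*e_{n+1} = e_{n+1}*e_n = e_n for all n, such that for every a ∈ R there is n with e_n*a*e_n = a. -/
theorem factor_aux {R : Type*} [NonUnitalRing R] (hs : RingIsSimple R) {p : R}
    (hp : IsInfiniteIdem p) (c : R) :
    ∃ X Y : R, X * p = X ∧ p * Y = Y ∧ X * Y = c := by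
  obtain ⟨f, g, hf, hg, hfg, hgf, rfl, ⟨x0, y0, hxy, hyx⟩, hg0⟩ := hp
  unfold IsIdem at hf hg
  have hq : (f + g) * (f + g) = f + g := by simp [mul_add, add_mul, hf, hg, hfg, hgf]
  have hqf : (f + g) * f = f := by simp [add_mul, hf, hgf]
  have hfq : f * (f + g) = f := by simp [mul_add, hf, hfg]
  have hqg : (f + g) * g = g := by simp [add_mul, hg, hfg]
  have hgq : g * (f + g) = g := by simp [mul_add, hg, hgf]
  generalize f + g = q at *
  obtain ⟨x, y, h1, h2, h3, h4, h5⟩ : ∃ x y : R, x * y = q ∧ x * g = 0 ∧ g * y = 0 ∧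
      x * q = x ∧ q * y = y := by
    refine ⟨q * x0 * f, f * y0 * q, ?_, ?_, ?_, ?_, ?_⟩
    · calc q * x0 * f * (f * y0 * q) = q * (x0 * (f * f) * y0) * q := by simp only [mul_assoc]
        _ = q * ((x0 * y0) * (x0 * y0)) * q := by rw [hf, ← hyx]; simp only [mul_assoc]
        _ = q := by rw [hxy, hq, hq, hq]
    · rw [mul_assoc, hfg, mul_zero]
    · rw [← mul_assoc, ← mul_assoc, hgf, zero_mul, zero_mul]
    · rw [mul_assoc, hfq]
    · rw [← mul_assoc, ← mul_assoc, hqf]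
  let S : Set R := {z | ∃ a b, z = a * g * b}
  have hclos : ∀ z ∈ AddSubgroup.closure S, ∀ c : R,
      (∃ X Y : R, X * q = X ∧ q * Y = Y ∧ X * Y = c) →
      ∃ X Y : R, X * q = X ∧ q * Y = Y ∧ X * Y = c + z := by
    have key : ∀ a b c : R, (∃ X Y : R, X * q = X ∧ q * Y = Y ∧ X * Y = c) →
      ∃ X Y : R, X * q = X ∧ q * Y = Y ∧ X * Y = c + a * g * b := by
      rintro a b c ⟨X, Y, hX, hY, rfl⟩
      refine ⟨X * x + a * g, y * Y + g * b, ?_, ?_, ?_⟩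
      · rw [add_mul, mul_assoc, h4, mul_assoc, hgq]
      · rw [mul_add, ← mul_assoc, h5, ← mul_assoc, hqg]
      · have e1 : X * x * (y * Y) = X * Y := by
          rw [mul_assoc, ← mul_assoc x, h1, hY]
        have e2 : X * x * (g * b) = 0 := by
          rw [mul_assoc, ← mul_assoc x, h2, zero_mul, mul_zero]
        have e3 : a * g * (y * Y) = 0 := by
          rw [mul_assoc, ← mul_assoc g, h3, zero_mul, mul_zero]
        have e4 : a * g * (g * b) = a * g * b := by
          rw [mul_assoc, ← mul_assoc g, hg, mul_assoc]
        rw [mul_add, add_mul, add_mul, e1, e2, e3, e4]; abel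
    have hneg : ∀ z ∈ S, -z ∈ S := by
      rintro z ⟨a, b, rfl⟩
      exact ⟨-a, b, by simp⟩
    intro z hz
    have : ∀ c : R, ((∃ X Y : R, X * q = X ∧ q * Y = Y ∧ X * Y = c) →
      ∃ X Y : R, X * q = X ∧ q * Y = Y ∧ X * Y = c + z) ∧
      ((∃ X Y : R, X * q = X ∧ q * Y = Y ∧ X * Y = c) →
      ∃ X Y : R, X * q = X ∧ q * Y = Y ∧ X * Y = c + -z) := by
      induction hz using AddSubgroup.closure_induction with
      | mem z hz =>
        intro c
        constructor
        · obtain ⟨a, b, rfl⟩ := hz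
          exact key a b c
        · obtain ⟨a, b, h⟩ := hneg z hz
          rw [h]
          exact key a b c
      | zero => intro c; simp
      | add z w _ _ hz hw =>
        intro c
        constructor
        · intro h
          rw [← add_assoc]
          exact (hw _).1 ((hz _).1 h)
        · intro h
          rw [neg_add, ← add_assoc]
          exact (hw _).2 ((hz _).2 h)
      | neg z _ hz =>
        intro c
        rw [neg_neg]
        exact (hz c).symm
    exact fun c => (this c).1
  have hid : IsTwoSidedIdealSet (AddSubgroup.closure S : Set R) := by
    refine ⟨zero_mem _, fun a ha b hb => add_mem ha hb, fun a ha => neg_mem ha, ?_⟩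
    intro a ha r
    induction ha using AddSubgroup.closure_induction with
    | mem z hz =>
      obtain ⟨a, b, rfl⟩ := hz
      exact ⟨AddSubgroup.subset_closure ⟨a, b * r, by simp only [mul_assoc]⟩,
        AddSubgroup.subset_closure ⟨r * a, b, by simp only [mul_assoc]⟩⟩
    | zero => simp
    | add z w _ _ hz hw =>
      rw [add_mul, mul_add]
      exact ⟨add_mem hz.1 hw.1, add_mem hz.2 hw.2⟩
    | neg z _ hz =>
      rw [neg_mul, mul_neg]
      exact ⟨neg_mem hz.1, neg_mem hz.2⟩
  have hgm : g ∈ (AddSubgroup.closure S : Set R) :=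
    AddSubgroup.subset_closure ⟨g, g, by rw [hg, hg]⟩
  rcases hs.2 _ hid with h | h
  · rw [h] at hgm
    exact absurd hgm hg0
  · have hc : c ∈ (AddSubgroup.closure S : Set R) := by rw [h]; trivial
    have := hclos c hc 0 ⟨0, 0, by simp, by simp, by simp⟩
    simpa using this

theorem idem_aux {R : Type*} [NonUnitalRing R] {a q X Y : R} (hq : q * q = q)
    (hXq : X * q = X) (hqY : q * Y = Y) (hqX : q * X = 0) (hYq : Y * q = 0)
    (hqa : q * a = 0) (haq : a * q = 0)
    (h1 : X * Y * a = a) (h2 : a * (X * Y) = a) :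
    ∃ e : R, IsIdem e ∧ e * a = a ∧ a * e = a := by
  have hXX : X * X = 0 := by
    calc X * X = X * (q * X) := by rw [← mul_assoc, hXq]
      _ = 0 := by rw [hqX, mul_zero]
  have hYY : Y * Y = 0 := by
    calc Y * Y = Y * q * Y := by rw [mul_assoc, hqY]
      _ = 0 := by rw [hYq, zero_mul]
  have aX : ∀ z, X * (X * z) = 0 := fun z => by rw [← mul_assoc, hXX, zero_mul]
  have aY : ∀ z, Y * (Y * z) = 0 := fun z => by rw [← mul_assoc, hYY, zero_mul]
  have aXq : ∀ z, X * (q * z) = X * z := fun z => by rw [← mul_assoc, hXq]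
  have aqY : ∀ z, q * (Y * z) = Y * z := fun z => by rw [← mul_assoc, hqY]
  have aqX : ∀ z, q * (X * z) = 0 := fun z => by rw [← mul_assoc, hqX, zero_mul]
  have aYq : ∀ z, Y * (q * z) = 0 := fun z => by rw [← mul_assoc, hYq, zero_mul]
  have aqq : ∀ z, q * (q * z) = q * z := fun z => by rw [← mul_assoc, hq]
  have aaq : ∀ z, a * (q * z) = 0 := fun z => by rw [← mul_assoc, haq, zero_mul]
  rw [mul_assoc] at h1
  have aXYa : ∀ z, a * (X * (Y * z)) = a * z := fun z => by
    rw [← mul_assoc X, ← mul_assoc, h2]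
  have haY : a * Y = 0 := by rw [← hqY, aaq]
  have hXa : X * a = 0 := by rw [← hXq, mul_assoc, hqa, mul_zero]
  have aaY : ∀ z, a * (Y * z) = 0 := fun z => by rw [← mul_assoc, haY, zero_mul]
  let P := X + X - X * Y * X + q - Y * X
  let Q := Y + q - Y * X
  have hQP : Q * P = q := by
    simp only [P, Q, mul_add, mul_sub, add_mul, sub_mul, mul_assoc, *, mul_zero]
    abel
  have hPq : P * q = P := by
    simp only [P, add_mul, sub_mul, mul_assoc, *]
  refine ⟨P * Q, ?_, ?_, ?_⟩
  · unfold IsIdem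
    rw [mul_assoc, ← mul_assoc Q, hQP, ← mul_assoc, hPq]
  · have : Q * a = Y * a := by
      simp only [Q, add_mul, sub_mul, mul_assoc, *, mul_zero]
      abel
    rw [mul_assoc, this]
    simp only [P, add_mul, sub_mul, mul_assoc, *, mul_zero]
    abel
  · have : a * P = a * X := by
      simp only [P, mul_add, mul_sub, mul_assoc, *, mul_zero]
      abel
    rw [← mul_assoc, this]
    simp only [Q, mul_add, mul_sub, mul_assoc, *, mul_zero]
    abel

theorem local_aux {R : Type*} [NonUnitalRing R] (hR : PurelyInfiniteSimple R)
    (hu : ∀ a : R, ∃ u, u * a = a ∧ a * u = a) (a : R) :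
    ∃ e : R, IsIdem e ∧ e * a = a ∧ a * e = a := by
  obtain ⟨u, hua, hau⟩ := hu a
  obtain ⟨w, hwu, huw⟩ := hu u
  obtain ⟨t, htw, hwt⟩ := hu w
  obtain ⟨v, hvt, htv⟩ := hu t
  by_cases hv : ∀ r, v * r = r
  · refine ⟨v, hv v, hv a, ?_⟩
    have key : ∀ r, r * v = r := by
      intro r
      have h0 : ∀ s, (r - r * v) * s = 0 := fun s => by rw [sub_mul, mul_assoc, hv, sub_self]
      obtain ⟨s, _, hs⟩ := hu (r - r * v)
      have := h0 s
      rw [hs] at this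
      exact (sub_eq_zero.1 this).symm
    exact key a
  · push Not at hv
    obtain ⟨r, hr⟩ := hv
    obtain ⟨p, ⟨s, rfl⟩, hp⟩ := hR.2 {z | ∃ s, z = s - v * s}
      ⟨⟨0, by simp⟩, by rintro _ ⟨s, rfl⟩ _ ⟨t, rfl⟩; exact ⟨s + t, by rw [mul_add]; abel⟩,
        by rintro _ ⟨s, rfl⟩; exact ⟨-s, by rw [mul_neg]; abel⟩,
        by rintro _ ⟨s, rfl⟩ t; exact ⟨s * t, by rw [sub_mul, mul_assoc]⟩⟩
      ⟨r - v * r, ⟨r, rfl⟩, fun h => hr (sub_eq_zero.1 h).symm⟩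
    have htp : t * (s - v * s) = 0 := by rw [mul_sub, ← mul_assoc, htv, sub_self]
    have hpp : (s - v * s) * (s - v * s) = s - v * s := by
      obtain ⟨f, g, hf, hg, hfg, hgf, h, -⟩ := hp
      unfold IsIdem at hf hg
      rw [h]; simp [mul_add, add_mul, hf, hg, hfg, hgf]
    obtain ⟨X, Y, hX, hY, hXY⟩ := factor_aux hR.1 hp u
    generalize s - v * s = p at *
    obtain ⟨q, rfl⟩ : ∃ q, q = p - p * t := ⟨_, rfl⟩
    have hqp : (p - p * t) * p = p := by rw [sub_mul, mul_assoc, htp, hpp, mul_zero, sub_zero]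
    have hqq : (p - p * t) * (p - p * t) = p - p * t := by
      rw [mul_sub, ← mul_assoc, hqp]
    have htq : t * (p - p * t) = 0 := by rw [mul_sub, ← mul_assoc, htp, zero_mul, sub_zero]
    have hwq : w * (p - p * t) = 0 := by
      rw [← hwt, mul_assoc, htq, mul_zero]
    have hqw : (p - p * t) * w = 0 := by
      rw [sub_mul, mul_assoc, htw, sub_self]
    generalize p - p * t = q at *
    have hqY : q * Y = Y := by rw [← hY, ← mul_assoc, hqp]
    have hwa : w * a = a := by rw [← hua, ← mul_assoc, hwu]
    have haw : a * w = a := by rw [← hau, mul_assoc, huw]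
    have hprod : w * (X * q) * (Y * w) = u := by
      calc w * (X * q) * (Y * w) = w * (X * (q * Y)) * w := by simp only [mul_assoc]
        _ = u := by rw [hqY, hXY, hwu, huw]
    refine idem_aux (q := q) (X := w * (X * q)) (Y := Y * w) hqq ?_ ?_ ?_ ?_ ?_ ?_ ?_ ?_
    · simp only [mul_assoc, hqq]
    · rw [← mul_assoc, hqY]
    · rw [← mul_assoc, hqw, zero_mul]
    · rw [mul_assoc, hwq, mul_zero]
    · rw [← hwa, ← mul_assoc, hqw, zero_mul]
    · rw [← haw, mul_assoc, hwq, mul_zero]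
    · rw [hprod, hua]
    · rw [hprod, hau]

/-- Every σ-unital purely infinite simple ring has a countable unit. -/
theorem sigmaUnital_purelyInfiniteSimple_countableUnit {R : Type*} [NonUnitalRing R]
    (hR : PurelyInfiniteSimple R)
    (hsigma : ∃ u : ℕ → R, ∀ a : R, ∃ N : ℕ, ∀ n ≥ N, u n * a = a ∧ a * u n = a) :
    ∃ e : ℕ → R, (∀ n, IsIdem (e n)) ∧
      (∀ n, e n * e (n + 1) = e n ∧ e (n + 1) * e n = e n) ∧
      ∀ a : R, ∃ n, e n * a * e n = a := by
  obtain ⟨u, hu⟩ := hsigma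
  have hu1 : ∀ a : R, ∃ u, u * a = a ∧ a * u = a := fun a => by
    obtain ⟨N, hN⟩ := hu a
    exact ⟨u N, hN N le_rfl⟩
  have step : ∀ (n : ℕ) (e : R), ∃ e' : R, IsIdem e' ∧ (e' * e = e ∧ e * e' = e) ∧
      e' * u n = u n ∧ u n * e' = u n := by
    intro n e
    obtain ⟨N, hN⟩ := hu e
    obtain ⟨M, hM⟩ := hu (u n)
    obtain ⟨h1, h2⟩ := hN (max N M) (le_max_left _ _)
    obtain ⟨h3, h4⟩ := hM (max N M) (le_max_right _ _)
    obtain ⟨e', he, h5, h6⟩ := local_aux hR hu1 (u (max N M))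
    refine ⟨e', he, ⟨?_, ?_⟩, ?_, ?_⟩
    · rw [← h1, ← mul_assoc, h5]
    · rw [← h2, mul_assoc, h6]
    · rw [← h3, ← mul_assoc, h5]
    · rw [← h4, mul_assoc, h6]
  choose F hF1 hF2 hF3 using step
  let e : ℕ → R := fun n => Nat.rec 0 (fun k x => F k x) n
  have he : ∀ n, e (n + 1) = F n (e n) := fun n => rfl
  refine ⟨e, ?_, ?_, ?_⟩
  · intro n
    cases n with
    | zero => exact mul_zero _
    | succ n => rw [he]; exact hF1 _ _
  · intro n
    rw [he]
    exact (hF2 n (e n)).symm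
  · intro a
    obtain ⟨N, hN⟩ := hu a
    obtain ⟨h1, h2⟩ := hN N le_rfl
    obtain ⟨h3, h4⟩ := hF3 N (e N)
    refine ⟨N + 1, ?_⟩
    rw [he]
    have e1 : F N (e N) * a = a := by rw [← h1, ← mul_assoc, h3]
    have e2 : a * F N (e N) = a := by rw [← h2, mul_assoc, h4]
    rw [e1, e2]
end

section
/- In a purely infinite simple ring, any nonzero idempotent is strictly subequivalent to any nonzero idempotent: if R is a purely infinite simple ring and e, f ∈ R are nonzero idempotents, then there exists an idempotent r ∈ R with r ~ e, r*f = f*r = r (i.e. r ≤ f), and r ≠ f. -/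
theorem pis_key {R : Type*} [NonUnitalRing R] (p g x y : R)
    (hpp : p * p = p) (hpg : p * g = g) (hgp : g * p = g) (hgg : g * g = g)
    (hxy : x * y = p) (hgy : g * y = 0) (hxg : x * g = 0) (hpy : p * y = y) (hxp : x * p = x)
    (z : R) (hz : z ∈ AddSubgroup.closure {w : R | ∃ s t, w = s * g * t}) :
    ∃ U V : R, V * U = z ∧ p * U = U ∧ V * p = V ∧ g * U = 0 ∧ V * g = 0 := by
  have step : ∀ z s t : R,
      (∃ U V : R, V * U = z ∧ p * U = U ∧ V * p = V ∧ g * U = 0 ∧ V * g = 0) →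
      (∃ U V : R, V * U = z + s * g * t ∧ p * U = U ∧ V * p = V ∧ g * U = 0 ∧ V * g = 0) := by
    rintro z s t ⟨U, V, h1, h2, h3, h4, h5⟩
    have hxy' : ∀ w, x * (y * w) = p * w := fun w => by rw [← mul_assoc, hxy]
    have hpg' : ∀ w, p * (g * w) = g * w := fun w => by rw [← mul_assoc, hpg]
    have hgg' : ∀ w, g * (g * w) = g * w := fun w => by rw [← mul_assoc, hgg]
    have hgy' : ∀ w, g * (y * w) = 0 := fun w => by rw [← mul_assoc, hgy, zero_mul]
    have hpy' : ∀ w, p * (y * w) = y * w := fun w => by rw [← mul_assoc, hpy]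
    have h5' : ∀ w, V * (g * w) = 0 := fun w => by rw [← mul_assoc, h5, zero_mul]
    refine ⟨y * U + y * (g * t), V * x + s * g * x, ?_, ?_, ?_, ?_, ?_⟩ <;>
    simp only [mul_add, add_mul, mul_assoc, hxy', hpg', hgg', hgy', hpy', h5', h1, h2, h4, hxp, hxg,
      mul_zero, add_zero, zero_add]
  induction hz using AddSubgroup.closure_induction_right with
  | zero => exact ⟨0, 0, by simp⟩
  | add_right a ha b hb ih =>
    obtain ⟨s, t, rfl⟩ := hb
    exact step _ s t ih
  | add_neg_cancel a ha b hb ih =>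
    obtain ⟨s, t, rfl⟩ := hb
    have := step _ (-s) t ih
    simpa only [neg_mul] using this

theorem pis_full {R : Type*} [NonUnitalRing R] (hR : RingIsSimple R) (g : R)
    (hgg : g * g = g) (hg : g ≠ 0) (z : R) :
    z ∈ AddSubgroup.closure {w : R | ∃ s t, w = s * g * t} := by
  have hid : IsTwoSidedIdealSet
      ((AddSubgroup.closure {w : R | ∃ s t, w = s * g * t} : AddSubgroup R) : Set R) := by
    refine ⟨zero_mem _, fun a ha b hb => add_mem ha hb, fun a ha => neg_mem ha, ?_⟩
    intro a ha r
    simp only [SetLike.mem_coe] at ha ⊢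
    induction ha using AddSubgroup.closure_induction with
    | mem w hw =>
      obtain ⟨s, t, rfl⟩ := hw
      exact ⟨AddSubgroup.subset_closure ⟨s, t * r, by simp only [mul_assoc]⟩,
        AddSubgroup.subset_closure ⟨r * s, t, by simp only [mul_assoc]⟩⟩
    | zero => simp [zero_mem]
    | add a b _ _ h1 h2 =>
      rw [add_mul, mul_add]
      exact ⟨add_mem h1.1 h2.1, add_mem h1.2 h2.2⟩
    | neg a _ h =>
      rw [neg_mul, mul_neg]
      exact ⟨neg_mem h.1, neg_mem h.2⟩
  rcases hR.2 _ hid with h | h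
  · exfalso
    apply hg
    have : g ∈ ((AddSubgroup.closure {w : R | ∃ s t, w = s * g * t} : AddSubgroup R) : Set R) :=
      AddSubgroup.subset_closure ⟨g, g, by rw [hgg, hgg]⟩
    rw [h] at this
    exact this
  · have : z ∈ (Set.univ : Set R) := trivial
    rw [← h] at this
    exact this

/-- In a purely infinite simple ring any nonzero idempotent is strictly subequivalent
to any nonzero idempotent. -/
theorem purelyInfiniteSimple_strict_subequivalence {R : Type*} [NonUnitalRing R]
    (hR : PurelyInfiniteSimple R) (e f : R) (he : IsIdem e) (hf : IsIdem f)
    (hene : e ≠ 0) (hfne : f ≠ 0) :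
    ∃ r : R, IsIdem r ∧ IdemEquiv r e ∧ r * f = r ∧ f * r = r ∧ r ≠ f := by
  obtain ⟨p, hp, p1, g, h1, hgg, h1g, hg1, hpe, ⟨x, y, hxy, hyx⟩, hg⟩ :=
    hR.2 {a | f * a = a}
      ⟨mul_zero f, fun a ha b hb => by
          simp only [Set.mem_setOf_eq] at *; rw [mul_add, ha, hb],
        fun a ha => by simp only [Set.mem_setOf_eq] at *; rw [mul_neg, ha],
        fun a ha r => by simp only [Set.mem_setOf_eq] at *; rw [← mul_assoc, ha]⟩ ⟨f, hf, hfne⟩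
  simp only [Set.mem_setOf_eq] at hp
  unfold IsIdem at *
  have hpg : p * g = g := by rw [hpe, add_mul, h1g, hgg, zero_add]
  have hgp : g * p = g := by rw [hpe, mul_add, hg1, hgg, zero_add]
  have hpp1 : p * p1 = p1 := by rw [hpe, add_mul, h1, hg1, add_zero]
  have hpp : p * p = p := by
    nth_rw 2 [hpe]; rw [mul_add, hpp1, hpg, ← hpe]
  have e1 : (p * x * p1) * (p1 * y * p) = p := by
    calc (p * x * p1) * (p1 * y * p) = p * x * (p1 * p1) * y * p := by simp only [mul_assoc]
      _ = p * (x * y) * (x * y) * p := by rw [h1, ← hyx]; simp only [mul_assoc]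
      _ = p := by simp only [hxy, hpp]
  obtain ⟨U, V, hVU, hpU, hVp, hgU, hVg⟩ := pis_key p g (p * x * p1) (p1 * y * p) hpp hpg hgp hgg e1
    (by rw [← mul_assoc, ← mul_assoc, hg1, zero_mul, zero_mul])
    (by rw [mul_assoc, h1g, mul_zero])
    (by rw [← mul_assoc, ← mul_assoc, hpp1])
    (by
      have : p1 * p = p1 := by rw [hpe, mul_add, h1, h1g, add_zero]
      rw [mul_assoc, this]) e (pis_full hR.1 g hgg hg e)
  have hfU : f * U = U := by rw [← hpU, ← mul_assoc, hp]
  have key : (e * V * f) * (U * e) = e := by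
    calc (e * V * f) * (U * e) = e * (V * (f * U)) * e := by simp only [mul_assoc]
      _ = e := by rw [hfU, hVU, he, he]
  have hfU' : f * (U * e) = U * e := by rw [← mul_assoc, hfU]
  have hVf : (e * V * f) * f = e * V * f := by rw [mul_assoc, hf]
  have hUe : (U * e) * e = U * e := by rw [mul_assoc, he]
  refine ⟨(U * e) * (e * V * f), ?_, ⟨U * e, e * V * f, rfl, key⟩, ?_, ?_, ?_⟩
  · calc (U * e) * (e * V * f) * ((U * e) * (e * V * f))
        = (U * e) * ((e * V * f) * (U * e)) * (e * V * f) := by simp only [mul_assoc]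
      _ = _ := by rw [key, hUe]
  · rw [mul_assoc, hVf]
  · rw [← mul_assoc, hfU']
  · intro h
    have hgf : g * f = 0 := by
      rw [← h, ← mul_assoc, ← mul_assoc g U e, hgU, zero_mul, zero_mul]
    apply hg
    rw [← hgp, ← hp, ← mul_assoc, hgf, zero_mul]
end

section
/- Cancellation of equivalent orthogonal summands in purely infinite simple rings: let R be a purely infinite simple ring, and let e, e', f, f' ∈ R be idempotents with e*e' = e'*e = 0 and f*f' = f'*f = 0. If e ~ f, e + e' ~ f + f', e' ≠ 0 and f' ≠ 0, then e' ~ f'. -/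
/-- Orthogonal decomposition `p = a + b` into idempotents. -/
structure OrthDec {A : Type*} [NonUnitalRing A] (p a b : A) : Prop where
  aa : a * a = a
  bb : b * b = b
  ab : a * b = 0
  ba : b * a = 0
  sum : p = a + b

section helpers

variable {A : Type*} [NonUnitalRing A]

theorem OrthDec.symm {p a b : A} (h : OrthDec p a b) : OrthDec p b a :=
  ⟨h.bb, h.aa, h.ba, h.ab, by rw [h.sum, add_comm]⟩

theorem OrthDec.idem {p a b : A} (h : OrthDec p a b) : p * p = p := by
  rw [h.sum]; simp [mul_add, add_mul, h.aa, h.bb, h.ab, h.ba]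

theorem OrthDec.pa {p a b : A} (h : OrthDec p a b) : p * a = a := by
  rw [h.sum]; simp [add_mul, h.aa, h.ba]

theorem OrthDec.ap {p a b : A} (h : OrthDec p a b) : a * p = a := by
  rw [h.sum]; simp [mul_add, h.aa, h.ab]

theorem OrthDec.of_le {p a : A} (hp : p * p = p) (ha : a * a = a) (h1 : p * a = a)
    (h2 : a * p = a) : OrthDec p a (p - a) :=
  ⟨ha, by simp [mul_sub, sub_mul, *], by simp [mul_sub, *], by simp [sub_mul, *], by abel⟩

theorem OrthDec.assoc {p a b c d : A} (h : OrthDec p a b) (k : OrthDec b c d) :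
    OrthDec p (a + c) d ∧ OrthDec (a + c) a c := by
  have ac : a * c = 0 := by rw [← k.pa, ← mul_assoc, h.ab, zero_mul]
  have ca : c * a = 0 := by rw [← k.ap, mul_assoc, h.ba, mul_zero]
  have ad : a * d = 0 := by rw [← k.symm.pa, ← mul_assoc, h.ab, zero_mul]
  have da : d * a = 0 := by rw [← k.symm.ap, mul_assoc, h.ba, mul_zero]
  have D : OrthDec (a + c) a c := ⟨h.aa, k.aa, ac, ca, rfl⟩
  refine ⟨⟨D.idem, k.bb, ?_, ?_, ?_⟩, D⟩
  · rw [add_mul, ad, k.ab, add_zero]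
  · rw [mul_add, da, k.ba, add_zero]
  · rw [h.sum, k.sum, add_assoc]

theorem IdemEquiv.symm' {p q : A} (h : IdemEquiv p q) : IdemEquiv q p := by
  obtain ⟨x, y, h1, h2⟩ := h
  exact ⟨y, x, h2, h1⟩

/-- Normal form for an equivalence of idempotents. -/
theorem IdemEquiv.normal {p q : A} (hp : p * p = p) (hq : q * q = q) (h : IdemEquiv p q) :
    ∃ x y : A, x * y = p ∧ y * x = q ∧ p * x = x ∧ x * q = x ∧ q * y = y ∧ y * p = y := by
  obtain ⟨x, y, h1, h2⟩ := h
  have e1 : p * x = x * q := by rw [← h1, ← h2, mul_assoc]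
  have e2 : q * y = y * p := by rw [← h1, ← h2, mul_assoc]
  refine ⟨p * x, q * y, ?_, ?_, ?_, ?_, ?_, ?_⟩
  · rw [e2, mul_assoc, ← mul_assoc x, h1, hp, hp]
  · rw [e1, mul_assoc, ← mul_assoc y, h2, hq, hq]
  · rw [← mul_assoc, hp]
  · rw [e1, mul_assoc, hq]
  · rw [← mul_assoc, hq]
  · rw [e2, mul_assoc, hp]

theorem IdemEquiv.trans' {p q r : A} (hp : p * p = p) (hq : q * q = q) (hr : r * r = r)
    (h : IdemEquiv p q) (k : IdemEquiv q r) : IdemEquiv p r := by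
  obtain ⟨x, y, h1, h2, h3, h4, h5, h6⟩ := h.normal hp hq
  obtain ⟨u, v, k1, k2, k3, k4, k5, k6⟩ := k.normal hq hr
  refine ⟨x * u, v * y, ?_, ?_⟩
  · rw [mul_assoc, ← mul_assoc u, k1, h5, h1]
  · rw [mul_assoc, ← mul_assoc y, h2, k3, k2]

theorem IdemEquiv.add' {p a b q c d : A} (h : OrthDec p a b) (k : OrthDec q c d)
    (h1 : IdemEquiv a c) (h2 : IdemEquiv b d) : IdemEquiv p q := by
  obtain ⟨x, y, x1, x2, x3, x4, x5, x6⟩ := h1.normal h.aa k.aa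
  obtain ⟨u, v, u1, u2, u3, u4, u5, u6⟩ := h2.normal h.bb k.bb
  have xv : x * v = 0 := by rw [← x4, ← u5, mul_assoc, ← mul_assoc c, k.ab, zero_mul, mul_zero]
  have uy : u * y = 0 := by rw [← u4, ← x5, mul_assoc, ← mul_assoc d, k.ba, zero_mul, mul_zero]
  have yu : y * u = 0 := by rw [← x6, ← u3, mul_assoc, ← mul_assoc a, h.ab, zero_mul, mul_zero]
  have vx : v * x = 0 := by rw [← u6, ← x3, mul_assoc, ← mul_assoc b, h.ba, zero_mul, mul_zero]
  refine ⟨x + u, y + v, ?_, ?_⟩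
  · rw [h.sum]; simp [mul_add, add_mul, *]
  · rw [k.sum]; simp [mul_add, add_mul, *]

theorem OrthDec.transport {p a b q : A} (h : OrthDec p a b) (hq : q * q = q)
    (k : IdemEquiv p q) : ∃ c d, OrthDec q c d ∧ IdemEquiv a c ∧ IdemEquiv b d := by
  obtain ⟨x, y, x1, x2, x3, x4, x5, x6⟩ := k.normal h.idem hq
  have key : ∀ s t : A, p * t = t → (y * s * x) * (y * t * x) = y * (s * t) * x := by
    intro s t ht
    calc (y * s * x) * (y * t * x) = y * s * ((x * y) * t) * x := by simp only [mul_assoc]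
      _ = _ := by rw [x1, ht]; simp only [mul_assoc]
  have eqv : ∀ s : A, s * s = s → p * s = s → s * p = s → IdemEquiv s (y * s * x) := by
    intro s hs h1 h2
    refine ⟨s * x, y * s, ?_, ?_⟩
    · rw [mul_assoc, ← mul_assoc x, x1, h1, hs]
    · rw [mul_assoc, ← mul_assoc s, hs, mul_assoc]
  refine ⟨y * a * x, y * b * x, ⟨?_, ?_, ?_, ?_, ?_⟩, eqv a h.aa h.pa h.ap,
    eqv b h.bb h.symm.pa h.symm.ap⟩
  · rw [key _ _ h.pa, h.aa]
  · rw [key _ _ h.symm.pa, h.bb]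
  · rw [key _ _ h.symm.pa, h.ab]; simp
  · rw [key _ _ h.pa, h.ba]; simp
  · rw [← add_mul, ← mul_add, ← h.sum, x6, x2]

theorem IdemEquiv.ne_zero' {p q : A} (hp : p * p = p) (h : IdemEquiv p q) (h0 : p ≠ 0) :
    q ≠ 0 := by
  obtain ⟨x, y, h1, h2⟩ := h
  rintro rfl
  apply h0
  rw [← hp, ← h1, mul_assoc, ← mul_assoc y, h2, zero_mul, mul_zero]

theorem IdemEquiv.refl' {p : A} (hp : p * p = p) : IdemEquiv p p := ⟨p, p, hp, hp⟩

/-- Every nonzero idempotent is infinite. -/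
theorem infinite_of_ne_zero (hR : PurelyInfiniteSimple A) {p : A} (hp : p * p = p)
    (h0 : p ≠ 0) : ∃ g h, OrthDec p g h ∧ IdemEquiv p g ∧ h ≠ 0 := by
  obtain ⟨i, hi, f, g, hf, hg, hfg, hgf, hs, he, hg0⟩ := hR.2 {a | p * a = a}
    ⟨by simp, fun a ha b hb => by simp only [Set.mem_ofPred_eq] at *; rw [mul_add, ha, hb],
      fun a ha => by simp only [Set.mem_ofPred_eq] at *; rw [mul_neg, ha],
      fun a ha r => by simp only [Set.mem_ofPred_eq] at *; rw [← mul_assoc, ha]⟩ ⟨p, hp, h0⟩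
  change p * i = i at hi
  have D : OrthDec i f g := ⟨hf, hg, hfg, hgf, hs⟩
  have hii := D.idem
  have hj : (i * p) * (i * p) = i * p := by
    rw [mul_assoc, ← mul_assoc p, hi, ← mul_assoc, hii]
  have hij : IdemEquiv i (i * p) := ⟨i * p, i, by rw [mul_assoc, hi, hii], by rw [← mul_assoc, hii]⟩
  obtain ⟨f', g', D', hff, hgg⟩ := D.transport hj hij
  have E : OrthDec p (i * p) (p - i * p) :=
    OrthDec.of_le hp hj (by rw [← mul_assoc, hi]) (by rw [mul_assoc, hp])
  obtain ⟨F, G⟩ := E.symm.assoc D'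
  refine ⟨_, _, F, ?_, hgg.ne_zero' hg hg0⟩
  refine IdemEquiv.add' E.symm G (IdemEquiv.refl' E.bb) ?_
  exact (hij.symm'.trans' hj hii hf he).trans' hj hf D'.aa hff

/-- Finite sums of elements `a * h * b`. -/
inductive SumsThrough (h : A) : A → Prop
  | zero : SumsThrough h 0
  | cons (a b c : A) : SumsThrough h c → SumsThrough h (a * h * b + c)

theorem sumsThrough_all (hR : PurelyInfiniteSimple A) {h : A} (hh : h * h = h) (h0 : h ≠ 0)
    (c : A) : SumsThrough h c := by
  have hI : IsTwoSidedIdealSet {c : A | SumsThrough h c} := by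
    refine ⟨.zero, ?_, ?_, ?_⟩
    · intro a ha b hb
      induction ha with
      | zero => simpa using hb
      | cons x y z _ ih => 
        have := SumsThrough.cons x y _ ih
        rwa [← add_assoc] at this
    · intro a ha
      induction ha with
      | zero => simpa using SumsThrough.zero
      | cons x y z _ ih => 
        have := SumsThrough.cons (-x) y _ ih
        rw [neg_mul, neg_mul, ← neg_add] at this
        exact this
    · intro a ha r
      induction ha with
      | zero => simpa using SumsThrough.zero
      | cons x y z _ ih => 
        have h1 := SumsThrough.cons x (y * r) _ ih.1
        have h2 := SumsThrough.cons (r * x) y _ ih.2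
        constructor
        · simpa [add_mul, mul_assoc] using h1
        · simpa [mul_add, mul_assoc] using h2
  have hm : h ∈ {c : A | SumsThrough h c} := by
    have := SumsThrough.cons h h 0 (SumsThrough.zero (h := h))
    rwa [hh, hh, add_zero] at this
  rcases hR.1.2 _ hI with H | H
  · rw [H] at hm; exact absurd hm h0
  · have : c ∈ (Set.univ : Set A) := trivial
    rwa [← H] at this

/-- Every idempotent embeds in every nonzero idempotent. -/
theorem embeds (hR : PurelyInfiniteSimple A) {p q : A} (hp : p * p = p)
    (h0 : p ≠ 0) (hq : q * q = q) : ∃ a b, OrthDec p a b ∧ IdemEquiv q a := by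
  obtain ⟨g, h, D, hpg, hh0⟩ := infinite_of_ne_zero hR hp h0
  obtain ⟨x, y, x1, x2, x3, x4, x5, x6⟩ := hpg.normal hp D.aa
  have xh : x * h = 0 := by rw [← x4, mul_assoc, D.ab, mul_zero]
  have hy : h * y = 0 := by rw [← x5, ← mul_assoc, D.ba, zero_mul]
  have xp : x * p = x := by rw [← x4, mul_assoc, D.ap]
  have py : p * y = y := by rw [← x5, ← mul_assoc, D.pa]
  have fac : ∀ c, SumsThrough h c → ∃ X Y, X * Y = c ∧ X * p = X ∧ p * Y = Y := by
    intro c hc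
    induction hc with
    | zero => exact ⟨0, 0, by simp, by simp, by simp⟩
    | cons a b c _ ih =>
      obtain ⟨X, Y, h1, h2, h3⟩ := ih
      refine ⟨a * h + X * x, h * b + y * Y, ?_, ?_, ?_⟩
      · have e1 : a * h * (h * b) = a * h * b := by
          rw [← mul_assoc, mul_assoc a, D.bb]
        have e2 : a * h * (y * Y) = 0 := by
          rw [← mul_assoc, mul_assoc a, hy]; simp
        have e3 : X * x * (h * b) = 0 := by
          rw [← mul_assoc, mul_assoc X, xh]; simp
        have e4 : X * x * (y * Y) = c := by
          rw [← mul_assoc, mul_assoc X, x1, h2, h1]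
        rw [add_mul, mul_add, mul_add, e1, e2, e3, e4]; simp
      · rw [add_mul, mul_assoc, D.symm.ap, mul_assoc, xp]
      · rw [mul_add, ← mul_assoc, D.symm.pa, ← mul_assoc, py]
  obtain ⟨X, Y, h1, h2, h3⟩ := fac q (sumsThrough_all hR D.bb hh0 q)
  have ha : (Y * q * X) * (Y * q * X) = Y * q * X := by
    calc (Y * q * X) * (Y * q * X) = Y * (q * (X * Y) * q) * X := by simp only [mul_assoc]
      _ = _ := by rw [h1, hq, hq]
  refine ⟨Y * q * X, _, OrthDec.of_le hp ha ?_ ?_, q * X, Y * q, ?_, ?_⟩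
  · rw [← mul_assoc, ← mul_assoc, h3]
  · rw [mul_assoc, h2]
  · rw [mul_assoc, ← mul_assoc X, h1, hq, hq]
  · rw [mul_assoc, ← mul_assoc q, hq, mul_assoc]

end helpers

/-- Cancellation of equivalent orthogonal summands in purely infinite simple rings. -/
theorem purelyInfiniteSimple_cancellation {R : Type*} [NonUnitalRing R]
    (hR : PurelyInfiniteSimple R) (e e' f f' : R)
    (he : IsIdem e) (he' : IsIdem e') (hf : IsIdem f) (hf' : IsIdem f')
    (hee' : e * e' = 0) (he'e : e' * e = 0) (hff' : f * f' = 0) (hf'f : f' * f = 0)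
    (heqv : IdemEquiv e f) (hsum : IdemEquiv (e + e') (f + f'))
    (he'0 : e' ≠ 0) (hf'0 : f' ≠ 0) :
    IdemEquiv e' f' := by
  have De : OrthDec (e + e') e e' := ⟨he, he', hee', he'e, rfl⟩
  have Df : OrthDec (f + f') f f' := ⟨hf, hf', hff', hf'f, rfl⟩
  obtain ⟨g, h, D1, hg, hh0⟩ := infinite_of_ne_zero hR he' he'0
  obtain ⟨e1, w, D2, h1⟩ := embeds hR D1.bb hh0 he
  obtain ⟨e2, b, D3, h2⟩ := embeds hR hf' hf'0 he'
  obtain ⟨g2, k, D4, h3, h4⟩ := D1.transport D3.aa h2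
  obtain ⟨e3, w2, D5, h5, h6⟩ := D2.transport D4.bb h4
  obtain ⟨E1, E2⟩ := D1.assoc D2
  obtain ⟨F1, F2⟩ := D3.symm.assoc D4
  obtain ⟨F3, F4⟩ := F1.assoc D5
  have K1 : IdemEquiv (g + e1) (e + e') := IdemEquiv.add' E2 De.symm hg.symm' h1.symm'
  have K2 : IdemEquiv (b + g2) f' :=
    IdemEquiv.add' F2 D3.symm (IdemEquiv.refl' D3.bb)
      ((h3.symm'.trans' D4.aa D1.aa he' hg.symm').trans' D4.aa he' D3.aa h2)
  have K3 : IdemEquiv (b + g2 + e3) (f + f') :=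
    IdemEquiv.add' F4 Df.symm K2
      ((h5.symm'.trans' D5.aa D2.aa he h1.symm').trans' D5.aa he hf heqv)
  have K4 : IdemEquiv (g + e1) (b + g2 + e3) :=
    (K1.trans' E2.idem De.idem Df.idem hsum).trans' E2.idem Df.idem F4.idem K3.symm'
  exact IdemEquiv.add' E1 F3 K4 h6
end

section
/- Every nonzero idempotent in a purely infinite simple ring is infinite: if R is a simple ring in which every nonzero right ideal contains an infinite idempotent, and q ∈ R is a nonzero idempotent, then there exist orthogonal idempotents f, g ∈ R with q = f + g, q ~ f, and g ≠ 0. -/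
/-- Every nonzero idempotent in a purely infinite simple ring is infinite. -/
theorem purelyInfiniteSimple_idem_infinite {R : Type*} [NonUnitalRing R]
    (hR : PurelyInfiniteSimple R) (q : R) (hq : IsIdem q) (hqne : q ≠ 0) :
    ∃ f g : R, IsIdem f ∧ IsIdem g ∧ f * g = 0 ∧ g * f = 0 ∧ q = f + g ∧
      IdemEquiv q f ∧ g ≠ 0 := by
  obtain ⟨-, h⟩ := hR
  have hq' : q * q = q := hq
  obtain ⟨e, ⟨r, hr⟩, f, g, hf, hg, hfg, hgf, hefg, ⟨x, y, hxy, hyx⟩, hg0⟩ :=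
    h {a | ∃ r, a = q * r} ⟨⟨0, by simp⟩, by
      rintro _ ⟨a, rfl⟩ _ ⟨b, rfl⟩
      exact ⟨a + b, by rw [mul_add]⟩, by
      rintro _ ⟨a, rfl⟩
      exact ⟨-a, by rw [mul_neg]⟩, by
      rintro _ ⟨a, rfl⟩ r
      exact ⟨a * r, by rw [mul_assoc]⟩⟩ ⟨q, ⟨q, hq'.symm⟩, hqne⟩
  unfold IsIdem at hf hg
  have qe : q * e = e := by rw [hr, ← mul_assoc, hq']
  clear hr h
  have ef : e * f = f := by rw [hefg, add_mul, hf, hgf, add_zero]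
  have fe : f * e = f := by rw [hefg, mul_add, hf, hfg, add_zero]
  have ee : e * e = e := by
    nth_rw 2 [hefg]; rw [mul_add, ef, hefg, add_mul, hfg, hg, zero_add]
  have qf : q * f = f := by rw [← ef, ← mul_assoc, qe]
  have hgd : g = e - f := by rw [hefg]; abel
  have qg : q * g = g := by rw [hgd, mul_sub, qe, qf]
  obtain ⟨X, hX⟩ : ∃ X, X = e * x * f := ⟨_, rfl⟩
  obtain ⟨Y, hY⟩ : ∃ Y, Y = f * y * e := ⟨_, rfl⟩
  have eX : e * X = X := by rw [hX, ← mul_assoc, ← mul_assoc, ee]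
  have Xf : X * f = X := by rw [hX, mul_assoc, hf]
  have Xe : X * e = X := by rw [hX, mul_assoc, fe]
  have fY : f * Y = Y := by rw [hY, ← mul_assoc, ← mul_assoc, hf]
  have eY : e * Y = Y := by rw [hY, ← mul_assoc, ← mul_assoc, ef]
  have Ye : Y * e = Y := by rw [hY, mul_assoc, ee]
  have qX : q * X = X := by rw [← eX, ← mul_assoc, qe]
  have qY : q * Y = Y := by rw [← fY, ← mul_assoc, qf]
  have XY : X * Y = e := by
    calc X * Y = e * x * (f * f) * y * e := by rw [hX, hY]; simp only [mul_assoc]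
      _ = e * (x * y) * (x * y) * e := by rw [hf, ← hyx]; simp only [mul_assoc]
      _ = e := by rw [hxy, ee, ee, ee]
  have YX : Y * X = f := by
    calc Y * X = f * y * (e * e) * x * f := by rw [hX, hY]; simp only [mul_assoc]
      _ = f * (y * x) * (y * x) * f := by rw [ee, ← hxy]; simp only [mul_assoc]
      _ = f := by rw [hyx, hf, hf, hf]
  clear hX hY
  have as : ∀ {u v w : R}, u * v = w → ∀ z, u * (v * z) = w * z := by
    intro u v w h z; rw [← mul_assoc, h]
  refine ⟨f * q + (q - e * q), g * q, ?_, ?_, ?_, ?_, ?_,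
    ⟨X * q + (q - e * q), Y * q + (q - e * q), ?_, ?_⟩, ?_⟩
  case refine_8 =>
    intro h0
    apply hg0
    rw [← hg]
    nth_rw 2 [← qg]
    rw [← mul_assoc, h0, zero_mul]
  all_goals
    clear hefg hg hfg hgf qg
    subst hgd
    simp only [IsIdem, mul_add, add_mul, mul_sub, sub_mul, mul_assoc, hq', qe, qf, ef, fe, ee, hf,
      eX, Xf, Xe, fY, eY, Ye, qX, qY, XY, YX, as hq', as qe, as qf, as ef, as fe, as ee, as hf,
      as eX, as Xf, as Xe, as fY, as eY, as Ye, as qX, as qY, as XY, as YX]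
    try abel
end

section
/- If e is an infinite idempotent in a simple ring R, then for every natural number n there exist pairwise orthogonal idempotents f_1, ..., f_n ∈ R such that each f_i satisfies e*f_i = f_i*e = f_i (i.e. f_i ∈ eRe) and f_i ~ e. (Equivalently, n copies of eR embed as a direct summand of eR, which yields a module epimorphism from eR onto n(eR).) -/
/-- `z` factors as `U * V` with `U`, `V` supported off a full copy of `e`. -/
def GoodFactor {R : Type*} [NonUnitalRing R] (e z : R) : Prop :=
  ∃ U V X Y : R, z = U * V ∧ X * Y = e ∧ U * Y = 0 ∧ X * V = 0 ∧ U * e = U ∧ e * V = V ∧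
    e * X = X ∧ X * e = X ∧ e * Y = Y ∧ Y * e = Y

theorem goodFactor_ideal {R : Type*} [NonUnitalRing R] (e : R) (he : e * e = e) :
    IsTwoSidedIdealSet {z : R | GoodFactor e z} := by
  refine ⟨⟨0, 0, e, e, by simp [he]⟩, ?_, ?_, ?_⟩
  · rintro z₁ ⟨U, V, X, Y, rfl, hXY, hUY, hXV, hUe, heV, heX, hXe, heY, hYe⟩
      z₂ ⟨U', V', X', Y', rfl, hXY', hUY', hXV', hUe', heV', heX', hXe', heY', hYe'⟩
    refine ⟨U + U' * X, V + Y * V', X' * X, Y * Y', ?_, ?_, ?_, ?_, ?_, ?_, ?_, ?_, ?_, ?_⟩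
    · have h1 : U * (Y * V') = 0 := by rw [← mul_assoc, hUY, zero_mul]
      have h2 : U' * X * V = 0 := by rw [mul_assoc, hXV, mul_zero]
      have h3 : U' * X * (Y * V') = U' * V' := by
        rw [mul_assoc, ← mul_assoc X, hXY, heV']
      rw [add_mul, mul_add, mul_add, h1, h2, h3]; simp
    · rw [mul_assoc, ← mul_assoc X, hXY, heY', hXY']
    · rw [add_mul, ← mul_assoc, hUY, mul_assoc U', ← mul_assoc X, hXY, heY', hUY']; simp
    · rw [mul_add, mul_assoc, hXV, mul_assoc X', ← mul_assoc X, hXY, heV', hXV']; simp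
    · rw [add_mul, mul_assoc, hXe, hUe]
    · rw [mul_add, ← mul_assoc, heY, heV]
    · rw [← mul_assoc, heX']
    · rw [mul_assoc, hXe]
    · rw [← mul_assoc, heY]
    · rw [mul_assoc, hYe']
  · rintro z ⟨U, V, X, Y, rfl, hXY, hUY, hXV, h⟩
    exact ⟨-U, V, X, Y, by simp, hXY, by simp [hUY], hXV, by simp [h.1], h.2⟩
  · rintro z ⟨U, V, X, Y, rfl, hXY, hUY, hXV, hUe, heV, h⟩ r
    exact ⟨⟨U, V * r, X, Y, by rw [mul_assoc], hXY, hUY, by rw [← mul_assoc, hXV, zero_mul],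
      hUe, by rw [← mul_assoc, heV], h⟩,
      ⟨r * U, V, X, Y, by rw [mul_assoc], hXY, by rw [mul_assoc, hUY, mul_zero], hXV,
      by rw [mul_assoc, hUe], heV, h⟩⟩

theorem goodFactor_of_infinite {R : Type*} [NonUnitalRing R]
    (hs : RingIsSimple R) (e : R) (he : IsInfiniteIdem e) : e * e = e ∧ GoodFactor e e := by
  obtain ⟨f, g, hf, hg, hfg, hgf, hefg, ⟨x, y, hxy, hyx⟩, hg0⟩ := he
  unfold IsIdem at hf hg
  have hee : e * e = e := by rw [hefg]; simp [mul_add, add_mul, hf, hg, hfg, hgf]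
  have hef : e * f = f := by rw [hefg]; simp [add_mul, hf, hgf]
  have hfe : f * e = f := by rw [hefg]; simp [mul_add, hf, hfg]
  have heg : e * g = g := by rw [hefg]; simp [add_mul, hg, hfg]
  have hge : g * e = g := by rw [hefg]; simp [mul_add, hg, hgf]
  refine ⟨hee, ?_⟩
  have hgood : GoodFactor e g := by
    refine ⟨g, g, e * x * f, f * y * e, hg.symm, ?_, ?_, ?_, hge, heg, ?_, ?_, ?_, ?_⟩
    · calc e * x * f * (f * y * e) = e * x * (f * f) * y * e := by simp only [mul_assoc]
        _ = e * (x * y) * (x * y) * e := by rw [hf, ← hyx]; simp only [mul_assoc]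
        _ = e := by rw [hxy, hee, hee, hee]
    · rw [← mul_assoc, ← mul_assoc, hgf]; simp
    · rw [mul_assoc, hfg, mul_zero]
    · rw [← mul_assoc, ← mul_assoc, hee]
    · rw [mul_assoc, hfe]
    · rw [← mul_assoc, ← mul_assoc, hef]
    · rw [mul_assoc, hee]
  rcases hs.2 _ (goodFactor_ideal e hee) with h | h
  · have : g ∈ ({0} : Set R) := h ▸ hgood
    exact absurd this hg0
  · have : e ∈ {z : R | GoodFactor e z} := h ▸ Set.mem_univ e
    exact this

/-- If `e` is an infinite idempotent in a simple ring, then for every `n` there are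
`n` pairwise orthogonal idempotents in `eRe`, each equivalent to `e`. -/
theorem infinite_idem_orthogonal_copies {R : Type*} [NonUnitalRing R]
    (hs : RingIsSimple R) (e : R) (he : IsInfiniteIdem e) :
    ∀ n : ℕ, ∃ f : Fin n → R, (∀ i, IsIdem (f i)) ∧
      (∀ i j, i ≠ j → f i * f j = 0) ∧
      (∀ i, e * f i = f i ∧ f i * e = f i ∧ IdemEquiv (f i) e) := by
  obtain ⟨hee, U, V, X, Y, hUV, hXY, hUY, hXV, hUe, heV, heX, hXe, heY, hYe⟩ :=
    goodFactor_of_infinite hs e he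
  have hUV' : e * U * (V * e) = e := by
    rw [mul_assoc, ← mul_assoc U, ← hUV, hee, hee]
  have hp : V * e * (e * U) * (V * e * (e * U)) = V * e * (e * U) := by
    rw [mul_assoc, ← mul_assoc (e * U), hUV', ← mul_assoc e e U, hee]
  have hmid : ∀ a b : R, Y * a * X * (Y * b * X) = Y * (a * e * b) * X := by
    intro a b
    rw [← hXY]; simp only [mul_assoc]
  intro n
  induction n with
  | zero => exact ⟨fun i => i.elim0, fun i => i.elim0, fun i => i.elim0, fun i => i.elim0⟩
  | succ n ih =>
    obtain ⟨f, hf, hff, hfe⟩ := ih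
    have h0 : ∀ a, V * e * (e * U) * (Y * a * X) = 0 := by
      intro a
      rw [mul_assoc, mul_assoc e, ← mul_assoc U, ← mul_assoc U, hUY]; simp
    have h1 : ∀ a, Y * a * X * (V * e * (e * U)) = 0 := by
      intro a
      rw [mul_assoc, ← mul_assoc X, ← mul_assoc X, hXV]; simp
    refine ⟨Fin.cons (V * e * (e * U)) (fun i => Y * f i * X), ?_, ?_, ?_⟩
    · intro i
      refine Fin.cases ?_ (fun i => ?_) i
      · exact hp
      · simp only [Fin.cons_succ, IsIdem]
        rw [hmid, (hfe i).2.1, hf i]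
    · intro i j
      refine Fin.cases ?_ (fun i => ?_) i <;> refine Fin.cases ?_ (fun j => ?_) j
      · intro h; exact absurd rfl h
      · intro _; exact h0 _
      · intro _; exact h1 _
      · intro h
        simp only [Fin.cons_succ]
        rw [hmid, (hfe i).2.1, hff i j (fun h' => h (by rw [h']))]; simp
    · intro i
      refine Fin.cases ?_ (fun i => ?_) i
      · simp only [Fin.cons_zero]
        refine ⟨?_, ?_, V * e, e * U, rfl, hUV'⟩
        · rw [← mul_assoc, ← mul_assoc e V, heV]
        · rw [mul_assoc, mul_assoc e, hUe]
      · simp only [Fin.cons_succ]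
        obtain ⟨-, hfe', a, b, hab, hba⟩ := hfe i
        have hfi : f i * f i = f i := hf i
        refine ⟨?_, ?_, Y * f i * a, b * f i * X, ?_, ?_⟩
        · rw [← mul_assoc, ← mul_assoc, heY]
        · rw [mul_assoc, hXe]
        · calc Y * f i * a * (b * f i * X) = Y * (f i * (a * b) * f i) * X := by
                simp only [mul_assoc]
            _ = Y * f i * X := by rw [hab, hfi, hfi]
        · calc b * f i * X * (Y * f i * a) = b * (f i * (X * Y) * f i) * a := by
                simp only [mul_assoc]
            _ = b * (a * b) * a := by rw [hXY, hfe', hfi, hab]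
            _ = (b * a) * (b * a) := by simp only [mul_assoc]
            _ = e := by rw [hba, hee]
end

section
/- Corner rings of sums of orthogonal equivalent idempotents are matrix rings: let R be a ring, q ∈ R an idempotent, and p_1, ..., p_n ∈ R pairwise orthogonal idempotents with p_i ~ q for all i. Set t = p_1 + ... + p_n. Then the corner ring tRt = {x ∈ R : t*x*t = x} is isomorphic, as a ring, to the ring M_n(qRq) of n×n matrices over the corner ring qRq = {y ∈ R : q*y*q = y}. -/
/-- The corner `tRt = {x ∈ R : t*x*t = x}` of an idempotent `t`, as a non-unital
subring of `R`. -/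
def corner {A : Type*} [NonUnitalRing A] (t : A) (ht : t * t = t) :
    NonUnitalSubring A where
  carrier := {x | t * x * t = x}
  zero_mem' := by simp
  add_mem' := by
    intro a b ha hb
    simp only [Set.mem_setOf_eq] at *
    rw [mul_add, add_mul, ha, hb]
  neg_mem' := by
    intro a ha
    simp only [Set.mem_setOf_eq] at *
    rw [mul_neg, neg_mul, ha]
  mul_mem' := by
    intro a b ha hb
    simp only [Set.mem_setOf_eq] at *
    have h1 : t * a = a := by rw [← ha, ← mul_assoc, ← mul_assoc, ht]
    have h2 : b * t = b := by rw [← hb, mul_assoc (t * b) t t, ht]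
    rw [← mul_assoc t a b, mul_assoc (t * a) b t, h1, h2]

/-- A sum of pairwise orthogonal idempotents is an idempotent. -/
theorem sum_orth_idem {A : Type*} [NonUnitalRing A] {n : ℕ} {p : Fin n → A}
    (hp : ∀ i, p i * p i = p i) (horth : ∀ i j, i ≠ j → p i * p j = 0) :
    (∑ i, p i) * (∑ i, p i) = ∑ i, p i := by
  rw [Finset.sum_mul_sum]
  refine Finset.sum_congr rfl fun i _ => ?_
  rw [Finset.sum_eq_single i (fun j _ hj => horth i j (Ne.symm hj))
    (fun h => absurd (Finset.mem_univ i) h)]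
  exact hp i

/-- Equivalences between idempotents can be normalised. -/
theorem IdemEquiv.normalize {R : Type*} [NonUnitalRing R] {p q : R}
    (hp : p * p = p) (hq : q * q = q) (h : IdemEquiv p q) :
    ∃ a b : R, a * b = p ∧ b * a = q ∧ p * a = a ∧ a * q = a ∧ b * p = b ∧ q * b = b := by
  obtain ⟨x, y, hxy, hyx⟩ := h
  have e1 : x * q = p * x := by rw [← hxy, ← hyx, mul_assoc]
  have e2 : y * p = q * y := by rw [← hxy, ← hyx, mul_assoc]
  refine ⟨p * x, q * y, ?_, ?_, ?_, ?_, ?_, ?_⟩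
  · rw [← e2, mul_assoc, ← mul_assoc x y p, hxy, hp, hp]
  · rw [← e1, mul_assoc, ← mul_assoc y x q, hyx, hq, hq]
  · rw [← mul_assoc, hp]
  · rw [mul_assoc, e1, ← mul_assoc, hp]
  · rw [mul_assoc, e2, ← mul_assoc, hq]
  · rw [← mul_assoc, hq]

theorem mem_corner_iff' {R : Type*} [NonUnitalRing R] {t : R} (ht : t * t = t) {x : R} :
    x ∈ corner t ht ↔ t * x * t = x := Iff.rfl

theorem corner_left {R : Type*} [NonUnitalRing R] {t : R} (ht : t * t = t) {x : R}
    (h : x ∈ corner t ht) : t * x = x := by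
  rw [mem_corner_iff'] at h
  rw [← h, ← mul_assoc, ← mul_assoc, ht]

/-- `tRt ≅ M_n(qRq)` when `t` is a sum of `n` pairwise orthogonal idempotents,
each equivalent to `q`. -/
theorem corner_iso_matrix_corner {R : Type*} [NonUnitalRing R] (n : ℕ)
    (q : R) (hq : q * q = q) (p : Fin n → R)
    (hp : ∀ i, p i * p i = p i)
    (horth : ∀ i j, i ≠ j → p i * p j = 0)
    (hequiv : ∀ i, IdemEquiv (p i) q) :
    Nonempty ((corner (∑ i, p i) (sum_orth_idem hp horth)) ≃+*
      Matrix (Fin n) (Fin n) (corner q hq)) := by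
  choose a b hab hba hpa haq hbp hqb using fun i => (hequiv i).normalize (hp i) hq
  have hort : ∀ i j, i ≠ j → b i * a j = 0 := by
    intro i j hij
    rw [← hbp i, ← hpa j, mul_assoc, ← mul_assoc (p i), horth i j hij, zero_mul, mul_zero]
  have hta : ∀ i, (∑ j, p j) * a i = a i := by
    intro i
    rw [Finset.sum_mul, Finset.sum_eq_single i, hpa]
    · intro j _ hj
      rw [← hpa i, ← mul_assoc, horth j i hj, zero_mul]
    · simp
  have hbt : ∀ i, b i * (∑ j, p j) = b i := by
    intro i
    rw [Finset.mul_sum, Finset.sum_eq_single i, hbp]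
    · intro j _ hj
      rw [← hbp i, mul_assoc, horth i j hj.symm, mul_zero]
    · simp
  refine ⟨{
    toFun := fun z => Matrix.of fun i j => ⟨b i * z.1 * a j, ?_⟩
    invFun := fun M => ⟨∑ i, ∑ j, a i * (M i j).1 * b j, ?_⟩
    left_inv := ?_
    right_inv := ?_
    map_mul' := ?_
    map_add' := ?_ }⟩
  · rw [mem_corner_iff', ← mul_assoc, ← mul_assoc, hqb, mul_assoc _ (a j) q, haq]
  · rw [mem_corner_iff']
    generalize (∑ j, p j) = t at hta hbt ⊢
    rw [Finset.mul_sum, Finset.sum_mul]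
    refine Finset.sum_congr rfl fun i _ => ?_
    rw [Finset.mul_sum, Finset.sum_mul]
    refine Finset.sum_congr rfl fun j _ => ?_
    rw [← mul_assoc, ← mul_assoc, hta, mul_assoc _ (b j), hbt]
  · intro z
    apply Subtype.ext
    have hz := z.2
    rw [mem_corner_iff', mul_assoc, Finset.sum_mul] at hz
    refine Eq.trans ?_ hz
    change (∑ i, ∑ j, a i * (b i * z.1 * a j) * b j) = _
    refine Finset.sum_congr rfl fun i _ => ?_
    rw [Finset.mul_sum, Finset.mul_sum]
    refine Finset.sum_congr rfl fun j _ => ?_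
    rw [← hab i, ← hab j]
    simp only [mul_assoc]
  · intro M
    ext i j
    simp only [Matrix.of_apply]
    rw [Finset.mul_sum, Finset.sum_mul, Finset.sum_eq_single i]
    · rw [Finset.mul_sum, Finset.sum_mul, Finset.sum_eq_single j]
      · rw [← mul_assoc, ← mul_assoc, hba, mul_assoc _ (b j), hba]
        exact (M i j).2
      · intro l _ hl
        rw [mul_assoc, mul_assoc _ (b l), hort l j hl, mul_zero, mul_zero]
      · simp
    · intro k _ hk
      rw [Finset.mul_sum, Finset.sum_mul]
      refine Finset.sum_eq_zero fun l _ => ?_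
      rw [← mul_assoc, ← mul_assoc, hort i k hk.symm, zero_mul, zero_mul, zero_mul]
    · simp
  · intro z w
    ext i j
    have hw := corner_left _ w.2
    simp only [Matrix.of_apply, Matrix.mul_apply, MulMemClass.coe_mul]
    rw [← NonUnitalSubringClass.coe_subtype (corner q hq), map_sum]
    simp only [NonUnitalSubringClass.coe_subtype, MulMemClass.coe_mul]
    conv_lhs => rw [← hw, Finset.sum_mul, Finset.mul_sum, Finset.mul_sum, Finset.sum_mul]
    refine Finset.sum_congr rfl fun k _ => ?_
    rw [← hab k]
    simp only [mul_assoc]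
  · intro z w
    ext i j
    simp [mul_add, add_mul]
end

section
/- The exchange property for (possibly non-unital) rings is left-right symmetric: a ring R satisfies that for every a ∈ R there exist an idempotent e ∈ R and elements r, s ∈ R with e = r*a and e = a + s - s*a, if and only if for every a ∈ R there exist an idempotent e' ∈ R and elements r', s' ∈ R with e' = a*r' and e' = a + s' - a*s'. -/
/-- Core computation, in a unital ring: with `c = p - t`, the element `a + a(1-a)c`
is idempotent. -/
theorem core_unital {S : Type*} [Ring S] (a c p e : S) (h1 : c * (1 - a) = p - 1)
    (h2 : p * a = e) (h3 : e * c = p) :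
    (a + a * (1 - a) * c) * (a + a * (1 - a) * c) = a + a * (1 - a) * c := by
  have h4 : c * a = c - p + 1 := by
    have : c * a = c - c * (1 - a) := by noncomm_ring
    rw [this, h1]; abel
  have h5 : c * (a * (1 - a)) * c = p - a * c := by
    have : c * (a * (1 - a)) * c = (c * (1 - a)) * a * c := by noncomm_ring
    rw [this, h1, sub_mul, h2, one_mul, sub_mul, h3]
  have h6 : (a + a * (1 - a) * c) * (a + a * (1 - a) * c)
      = a * a + a * (1 - a) * (a * c + c * a + c * (a * (1 - a)) * c) := by noncomm_ring
  rw [h6, h4, h5]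
  noncomm_ring

/-- The idempotent in the unital ring, written without using the unit. -/
theorem core_unital' {S : Type*} [Ring S] (a e r s : S) (he : e * e = e) (h1 : e = r * a)
    (h2 : e = a + s - s * a) :
    (a * a + (a - a * a) * (e * r + s + e - e * s)) *
      (a * a + (a - a * a) * (e * r + s + e - e * s)) =
      a * a + (a - a * a) * (e * r + s + e - e * s) := by
  have hpa : e * r * a = e := by rw [mul_assoc, ← h1, he]
  have hsa : s * a = a + s - e := by
    have : e + s * a = a + s := by rw [h2]; noncomm_ring
    rw [← this]; abel
  have hc : e * (e * r + s + e - e * s - 1) = e * r := by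
    have : e * (e * r + s + e - e * s - 1) = e * e * r + e * s + e * e - e * e * s - e := by
      noncomm_ring
    rw [this, he]; abel
  have hb : (e * r + s + e - e * s - 1) * (1 - a) = e * r - 1 := by
    have : (e * r + s + e - e * s - 1) * (1 - a) =
      e * r + s + e - e * s - 1 - (e * r * a + s * a + e * a - e * (s * a) - a) := by
      noncomm_ring
    rw [this, hpa, hsa, mul_sub, mul_add, he]; abel
  have key := core_unital a (e * r + s + e - e * s - 1) (e * r) e hb hpa hc
  have hg : a + a * (1 - a) * (e * r + s + e - e * s - 1) =
      a * a + (a - a * a) * (e * r + s + e - e * s) := by noncomm_ring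
  rwa [hg] at key

theorem exchange_forward {R : Type*} [NonUnitalRing R]
    (H : ∀ a : R, ∃ e r s : R, IsIdem e ∧ e = r * a ∧ e = a + s - s * a) :
    ∀ a : R, ∃ e r s : R, IsIdem e ∧ e = a * r ∧ e = a + s - a * s := by
  intro a
  obtain ⟨e, r, s, he, h1, h2⟩ := H a
  have inj : Function.Injective ((↑) : R → Unitization ℤ R) := Unitization.inr_injective
  have hg : (a * a + (a - a * a) * (e * r + s + e - e * s)) *
      (a * a + (a - a * a) * (e * r + s + e - e * s)) =
      a * a + (a - a * a) * (e * r + s + e - e * s) := by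
    apply inj
    have := core_unital' (a : Unitization ℤ R) e r s
      (by rw [← Unitization.inr_mul, he]) (by rw [← Unitization.inr_mul, ← h1])
      (by rw [← Unitization.inr_mul, ← Unitization.inr_add, ← Unitization.inr_sub, ← h2])
    simpa only [← Unitization.inr_mul, ← Unitization.inr_add, ← Unitization.inr_sub] using this
  generalize e * r + s + e - e * s = w at hg
  refine ⟨a * a + (a - a * a) * w, (w + a - a * w) * (a * a + (a - a * a) * w),
    a * w - a, hg, ?_, ?_⟩
  · rw [← mul_assoc]
    have : a * (w + a - a * w) = a * a + (a - a * a) * w := by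
      simp only [mul_add, mul_sub, sub_mul, mul_assoc]; abel
    rw [this, hg]
  · simp only [mul_sub, sub_mul, mul_assoc]; abel

/-- The exchange property for possibly non-unital rings is left-right symmetric. -/
theorem exchange_left_right_symmetric {R : Type*} [NonUnitalRing R] :
    (∀ a : R, ∃ e r s : R, IsIdem e ∧ e = r * a ∧ e = a + s - s * a) ↔
      (∀ a : R, ∃ e r s : R, IsIdem e ∧ e = a * r ∧ e = a + s - a * s) := by
  refine ⟨exchange_forward, fun H a => ?_⟩
  obtain ⟨e, r, s, he, h1, h2⟩ := exchange_forward (R := Rᵐᵒᵖ) (fun x => by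
    obtain ⟨e, r, s, he, h1, h2⟩ := H x.unop
    exact ⟨.op e, .op r, .op s, congrArg MulOpposite.op he, congrArg MulOpposite.op h1,
      congrArg MulOpposite.op h2⟩) (.op a)
  exact ⟨e.unop, r.unop, s.unop, congrArg MulOpposite.unop he, congrArg MulOpposite.unop h1,
    congrArg MulOpposite.unop h2⟩
end
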